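/- Let N ≥ 1, p > 1, m ≥ 1, q > max(p+m−2, 1), and let f, a be as in the setting. Suppose V(x,t) ≥ h(x) g(t) for a.e. (x,t) ∈ S, where h : ℝ^N → ℝ and g : (0,∞) → ℝ are measurable and satisfy, for some constants α1, α2, σ1, σ2, σ3, σ4, δ1, δ2, δ3, δ4 ≥ 0 and C > 0: C^{−1}(1+|x|)^{−α1} ≤ h(x) ≤ C(1+|x|)^{α1} a.e., C^{−1}(1+t)^{−α2} ≤ g(t) ≤ C(1+t)^{α2} a.e., and for all sufficiently large R and T: ∫_{B_R} h^{−1/(q−1)} dμ_a ≤ C R^{σ1}(log R)^{δ1}, ∫_0^T g^{−1/(q−1)} dt ≤ C T^{σ2}(log T)^{δ2}, ∫_{B_R} h^{−(p+m−2)/(q−p−m+2)} dμ_a ≤ C R^{σ3}(log R)^{δ3}, ∫_0^T g^{−(p+m−2)/(q−p−m+2)} dt ≤ C T^{σ4}(log T)^{δ4}. Assume further: (i) δ1+δ2 ≤ 1/(q−1) and δ3+δ4 ≤ (p+m−2)/(q−p−m+2); (ii) σ2 ≤ q/(q−1) and σ3 ≤ pq/(q−p−m+2); (iii) if σ2 =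 q/(q−1) then σ1 = 0, and if σ3 = pq/(q−p−m+2) then σ4 = 0; (iv) σ1·σ4 ≤ (q/(q−1) − σ2)·(pq/(q−p−m+2) − σ3). Then every global nonnegative weak solution of ∂_t u ≥ (1/a) div(a u^{m−1} |∇u|^{p−2} f(|∇u|) ∇u) + V u^q on S is zero a.e. (Euclidean specialization of the paper's Corollary 1.8.) -/

import Mathlib

open MeasureTheory Real Set Metric
open scoped ENNReal RealInnerProductSpace

noncomputable section

/-- Euclidean space `ℝ^N`. -/
abbrev Euc (N : ℕ) : Type := EuclideanSpace ℝ (Fin N)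

/-- The parabolic slab `S = ℝ^N × (0,∞)`. -/
def Sset (N : ℕ) : Set (Euc N × ℝ) := {z : Euc N × ℝ | 0 < z.2}

/-- The weighted measure `μ_a = a(x) dx` on `ℝ^N`. -/
def muA {N : ℕ} (a : Euc N → ℝ) : Measure (Euc N) :=
  (volume : Measure (Euc N)).withDensity (fun x => ENNReal.ofReal (a x))

/-- The measure `dμ_a dt` on `ℝ^N × (0,∞)`. -/
def muS {N : ℕ} (a : Euc N → ℝ) : Measure (Euc N × ℝ) :=
  (muA a).prod ((volume : Measure ℝ).restrict (Set.Ioi (0 : ℝ)))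

/-- The continuous linear functional `(w, τ) ↦ ⟪v, w⟫ + c·τ` on `ℝ^N × ℝ`,
encoding a space-time differential with spatial gradient `v` and time derivative `c`. -/
def pairCLM {N : ℕ} (v : Euc N) (c : ℝ) : (Euc N × ℝ) →L[ℝ] ℝ :=
  ((innerSL ℝ v).comp (ContinuousLinearMap.fst ℝ (Euc N) ℝ)) +
    c • (ContinuousLinearMap.snd ℝ (Euc N) ℝ)

/-- `u` is a global nonnegative weak solution of
`∂ₜ u ≥ (1/a) div(a u^{m-1} |∇u|^{p-2} f(|∇u|) ∇u) + V u^q` on `S = ℝ^N × (0,∞)`,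
where `gu`, `ut` are a.e. representatives of the spatial gradient and the time
derivative of `u`. -/
structure IsWeakSol (N : ℕ) (p m q : ℝ) (V : Euc N × ℝ → ℝ) (f : ℝ → ℝ)
    (a : Euc N → ℝ) (u : Euc N × ℝ → ℝ) (gu : Euc N × ℝ → Euc N)
    (ut : Euc N × ℝ → ℝ) : Prop where
  nonneg : ∀ z ∈ Sset N, 0 ≤ u z
  locLip : LocallyLipschitzOn (Sset N) u
  deriv_ae : ∀ᵐ z ∂ ((volume : Measure (Euc N × ℝ)).restrict (Sset N)),
      DifferentiableAt ℝ u z → HasFDerivAt u (pairCLM (gu z) (ut z)) z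
  int_uqV : LocallyIntegrableOn (fun z => u z ^ q * V z) (Sset N) (muS a)
  int_upm : LocallyIntegrableOn (fun z => u z ^ (p + m - 1)) (Sset N) (muS a)
  int_gu : LocallyIntegrableOn (fun z => ‖gu z‖ ^ p * u z ^ (m - 1)) (Sset N) (muS a)
  int_ut : LocallyIntegrableOn (fun z => u z * ut z) (Sset N) (muS a)
  weak_ineq : ∀ (ψ : Euc N × ℝ → ℝ) (gψ : Euc N × ℝ → Euc N) (tψ : Euc N × ℝ → ℝ),
      (∀ z, 0 ≤ ψ z) → LocallyLipschitz ψ → HasCompactSupport ψ →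
      tsupport ψ ⊆ Sset N →
      (∀ᵐ z ∂ (volume : Measure (Euc N × ℝ)),
        DifferentiableAt ℝ ψ z → HasFDerivAt ψ (pairCLM (gψ z) (tψ z)) z) →
      ∫ z, ψ z * u z ^ q * V z ∂ muS a ≤
        (∫ z, ⟪gψ z, gu z⟫ * u z ^ (m - 1) * ‖gu z‖ ^ (p - 2) * f ‖gu z‖ ∂ muS a)
          - ∫ z, tψ z * u z ∂ muS a

/-- The region `E_R = {(x,t) ∈ S : |x|^θ2 + t^θ1 ≤ R^θ2}`. -/
def ESet (N : ℕ) (θ1 θ2 R : ℝ) : Set (Euc N × ℝ) :=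
  {z ∈ Sset N | ‖z.1‖ ^ θ2 + z.2 ^ θ1 ≤ R ^ θ2}

/-- The time cutoff `χ_β`. -/
def chi (β t : ℝ) : ℝ := min 1 (max 0 (t / β - 1))

open scoped Topology NNReal

section Slab

variable {N : ℕ}

lemma isOpen_Sset : IsOpen (Sset N) := isOpen_lt continuous_const continuous_snd

lemma muS_eq_withDensity {a : Euc N → ℝ} (ha : Continuous a) :
    muS a = ((volume : Measure (Euc N × ℝ)).restrict (Sset N)).withDensity
      (fun z => ENNReal.ofReal (a z.1)) := by
  have h1 : (volume : Measure (Euc N × ℝ)).restrict (Sset N) =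
      (volume : Measure (Euc N)).prod ((volume : Measure ℝ).restrict (Set.Ioi (0 : ℝ))) := by
    have : Sset N = (univ : Set (Euc N)) ×ˢ Set.Ioi (0 : ℝ) := by
      ext z; simp [Sset]
    rw [this, Measure.volume_eq_prod, ← Measure.prod_restrict, Measure.restrict_univ]
  rw [h1, muS, muA, prod_withDensity_left]
  exact ha.measurable.ennreal_ofReal

lemma muS_absolutelyContinuous {a : Euc N → ℝ} (ha : Continuous a) :
    muS a ≪ (volume : Measure (Euc N × ℝ)).restrict (Sset N) := by
  rw [muS_eq_withDensity ha]; exact withDensity_absolutelyContinuous _ _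

lemma absolutelyContinuous_muS {a : Euc N → ℝ} (ha : Continuous a)
    (haPos : ∀ᵐ x ∂ (volume : Measure (Euc N)), 0 < a x) :
    (volume : Measure (Euc N × ℝ)).restrict (Sset N) ≪ muS a := by
  rw [muS_eq_withDensity ha]
  apply withDensity_absolutelyContinuous'
  · exact (ha.measurable.comp measurable_fst).ennreal_ofReal.aemeasurable
  · apply ae_restrict_of_ae
    have : ∀ᵐ z : Euc N × ℝ, 0 < a z.1 := by
      rw [Measure.volume_eq_prod]
      exact Measure.quasiMeasurePreserving_fst.ae haPos
    filter_upwards [this] with z hz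
    simpa using hz

lemma isLocallyFiniteMeasure_muA {a : Euc N → ℝ} (ha : Continuous a) :
    IsLocallyFiniteMeasure (muA a) := by
  unfold muA
  exact IsLocallyFiniteMeasure.withDensity_ofReal ha

lemma isLocallyFiniteMeasure_muS {a : Euc N → ℝ} (ha : Continuous a) :
    IsLocallyFiniteMeasure (muS a) := by
  rw [muS_eq_withDensity ha]
  exact IsLocallyFiniteMeasure.withDensity_ofReal (ha.comp continuous_fst)

lemma ae_muS_mem_Sset {a : Euc N → ℝ} (ha : Continuous a) : ∀ᵐ z ∂ muS a, z ∈ Sset N :=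
  (muS_absolutelyContinuous ha).ae_le (ae_restrict_mem isOpen_Sset.measurableSet)

instance isAddHaarMeasure_volume_euc_prod :
    (volume : Measure (Euc N × ℝ)).IsAddHaarMeasure := by
  rw [Measure.volume_eq_prod]; infer_instance

instance sigmaFinite_muA {a : Euc N → ℝ} : SigmaFinite (muA a) := by
  unfold muA; infer_instance

end Slab

section LocalLipschitz

variable {E : Type*} [NormedAddCommGroup E]

/-- A real function that is Lipschitz in some neighborhood of the point `z`. -/
def LipNear (f : E → ℝ) (z : E) : Prop :=
  ∃ K : ℝ≥0, ∃ t ∈ 𝓝 z, LipschitzOnWith K f t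

lemma locallyLipschitz_iff_lipNear {f : E → ℝ} : LocallyLipschitz f ↔ ∀ z, LipNear f z :=
  Iff.rfl

lemma LocallyLipschitzOn.lipNear {f : E → ℝ} {U : Set E} (hf : LocallyLipschitzOn U f)
    (hU : IsOpen U) {z : E} (hz : z ∈ U) : LipNear f z := by
  obtain ⟨K, t, ht, h⟩ := hf hz
  rw [hU.nhdsWithin_eq hz] at ht
  exact ⟨K, t, ht, h⟩

lemma LipNear.continuousAt {f : E → ℝ} {z : E} (hf : LipNear f z) : ContinuousAt f z := by
  obtain ⟨K, t, ht, h⟩ := hf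
  exact h.continuousOn.continuousAt ht

lemma LipNear.congr {f g : E → ℝ} {z : E} (hf : LipNear f z) (hfg : f =ᶠ[𝓝 z] g) :
    LipNear g z := by
  obtain ⟨K, t, ht, h⟩ := hf
  refine ⟨K, t ∩ {x | f x = g x}, Filter.inter_mem ht hfg, ?_⟩
  intro x hx y hy
  rw [← hx.2, ← hy.2]
  exact h hx.1 hy.1

lemma LipNear.comp {f : E → ℝ} {H : ℝ → ℝ} {z : E} (hf : LipNear f z)
    (hH : ContDiffAt ℝ 1 H (f z)) : LipNear (fun x => H (f x)) z := by
  have hc := hf.continuousAt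
  obtain ⟨K, t, ht, h⟩ := hf
  obtain ⟨K', t', ht', h'⟩ := hH.exists_lipschitzOnWith
  refine ⟨K' * K, t ∩ f ⁻¹' t', Filter.inter_mem ht (hc ht'), ?_⟩
  exact h'.comp (h.mono inter_subset_left) (fun x hx => hx.2)

lemma LipNear.mul {f g : E → ℝ} {z : E} (hf : LipNear f z) (hg : LipNear g z) :
    LipNear (fun x => f x * g x) z := by
  have hcf := hf.continuousAt
  have hcg := hg.continuousAt
  obtain ⟨K, t, ht, h⟩ := hf
  obtain ⟨K₂, t₂, ht₂, h₂⟩ := hg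
  have hm : ContDiffAt ℝ 1 (fun w : ℝ × ℝ => w.1 * w.2) (f z, g z) := by fun_prop
  obtain ⟨K', t', ht', h'⟩ := hm.exists_lipschitzOnWith
  refine ⟨K' * max K K₂, (t ∩ t₂) ∩ (fun x => (f x, g x)) ⁻¹' t',
    Filter.inter_mem (Filter.inter_mem ht ht₂) ((hcf.prodMk hcg) ht'), ?_⟩
  have hp : LipschitzOnWith (max K K₂) (fun x => (f x, g x))
      ((t ∩ t₂) ∩ (fun x => (f x, g x)) ⁻¹' t') :=
    (h.mono fun x hx => hx.1.1).prodMk (h₂.mono fun x hx => hx.1.2)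
  exact h'.comp hp (fun x hx => hx.2)

lemma LipschitzWith.lipNear {f : E → ℝ} {K : ℝ≥0} (hf : LipschitzWith K f) (z : E) :
    LipNear f z := ⟨K, univ, Filter.univ_mem, hf.lipschitzOnWith⟩

lemma LocallyLipschitz.exists_lipschitzWith [ProperSpace E] {f : E → ℝ}
    (hf : LocallyLipschitz f) (hc : HasCompactSupport f) : ∃ K, LipschitzWith K f := by
  obtain ⟨R, hR⟩ := hc.isCompact.isBounded.subset_closedBall 0
  obtain ⟨M, hM⟩ := hf.continuous.bounded_above_of_compact_support hc
  have hM0 : 0 ≤ M := (norm_nonneg _).trans (hM 0)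
  obtain ⟨K, hK⟩ := (hf.locallyLipschitzOn (s := closedBall 0 (R + 1))
    ).exists_lipschitzOnWith_of_compact (isCompact_closedBall 0 (R + 1))
  have key : ∀ x y, ‖x‖ ≤ R → dist (f x) (f y) ≤ (K + 2 * M) * dist x y := by
    intro x y hx
    have hd := dist_nonneg (x := x) (y := y)
    by_cases hy : ‖y‖ ≤ R + 1
    · have := hK.dist_le_mul x (by simp; linarith) y (by simpa using hy)
      nlinarith
    · push Not at hy
      have h1 : 1 ≤ dist x y := by
        rw [dist_eq_norm, norm_sub_rev]
        have := norm_sub_norm_le y x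
        linarith
      have h2 : dist (f x) (f y) ≤ 2 * M := by
        rw [dist_eq_norm]
        have := norm_sub_le (f x) (f y)
        linarith [hM x, hM y]
      have := K.2
      have h3 : 0 ≤ (K : ℝ) * dist x y := by positivity
      nlinarith
  refine ⟨Real.toNNReal (K + 2 * M), LipschitzWith.of_dist_le_mul fun x y => ?_⟩
  rw [Real.coe_toNNReal _ (by positivity)]
  have hzero : ∀ x, ¬ ‖x‖ ≤ R → f x = 0 := fun x hx =>
    image_eq_zero_of_notMem_tsupport fun hx' => hx (by simpa using hR hx')
  by_cases hx : ‖x‖ ≤ R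
  · exact key x y hx
  by_cases hy : ‖y‖ ≤ R
  · rw [dist_comm, dist_comm x]; exact key y x hy
  · rw [hzero x hx, hzero y hy, dist_self]; positivity

lemma ae_differentiableAt_of_locallyLipschitzOn [NormedSpace ℝ E] [FiniteDimensional ℝ E] [MeasurableSpace E]
    [BorelSpace E] {μ : Measure E} [μ.IsAddHaarMeasure] {f : E → ℝ} {U : Set E}
    (hU : IsOpen U) (hf : LocallyLipschitzOn U f) :
    ∀ᵐ z ∂ μ.restrict U, DifferentiableAt ℝ f z := by
  rw [ae_restrict_iff' hU.measurableSet, ae_iff]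
  apply measure_null_of_locally_null
  intro x hx
  simp only [mem_ofPred_eq, Classical.not_imp] at hx
  obtain ⟨K, t, ht, h⟩ := hf.lipNear hU hx.1
  have ht' : interior t ∈ 𝓝 x := interior_mem_nhds.2 ht
  have hae := (h.mono interior_subset).ae_differentiableWithinAt_of_mem (μ := μ)
  rw [ae_iff] at hae
  refine ⟨{z | z ∈ U ∧ ¬ DifferentiableAt ℝ f z} ∩ interior t, ?_, ?_⟩
  · simp only [Classical.not_imp]
    exact Filter.inter_mem self_mem_nhdsWithin (mem_nhdsWithin_of_mem_nhds ht')
  · refine measure_mono_null ?_ hae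
    rintro z ⟨⟨_, hz⟩, hzt⟩
    simp only [mem_ofPred_eq, Classical.not_imp]
    exact ⟨hzt, fun h' => hz (h'.differentiableAt (isOpen_interior.mem_nhds hzt))⟩

end LocalLipschitz

section TestFunctions

variable {N : ℕ}

lemma integrable_of_bounded_of_support_subset {α : Type*} [MeasurableSpace α] {μ : Measure α}
    {C : Set α} (hC : μ C ≠ ∞) {F : α → ℝ} (hF : AEStronglyMeasurable F μ)
    {M : ℝ} (hM : ∀ z ∈ C, |F z| ≤ M) (h0 : ∀ z, z ∉ C → F z = 0) : Integrable F μ := by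
  have hM' : ∀ z, ‖F z‖ ≤ |M| := by
    intro z
    by_cases hz : z ∈ C
    · exact (hM z hz).trans (le_abs_self _)
    · rw [h0 z hz, norm_zero]; exact abs_nonneg _
  rw [← integrableOn_iff_integrable_of_support_subset (s := C)]
  · exact Measure.integrableOn_of_bounded hC hF (ae_of_all _ hM')
  · intro z hz
    by_contra h
    exact hz (h0 z h)

lemma differentiableAt_of_comp_snd {k : ℝ → ℝ} {z : Euc N × ℝ}
    (h : DifferentiableAt ℝ (fun z : Euc N × ℝ => k z.2) z) : DifferentiableAt ℝ k z.2 := by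
  have h1 : DifferentiableAt ℝ (fun t : ℝ => ((z.1, t) : Euc N × ℝ)) z.2 := by fun_prop
  exact DifferentiableAt.comp (f := fun t : ℝ => ((z.1, t) : Euc N × ℝ)) z.2 h h1

lemma fderiv_comp_snd {k : ℝ → ℝ} {z : Euc N × ℝ}
    (h : DifferentiableAt ℝ (fun z : Euc N × ℝ => k z.2) z) (v : Euc N × ℝ) :
    fderiv ℝ (fun z : Euc N × ℝ => k z.2) z v = v.2 * deriv k z.2 := by
  have h1 := (differentiableAt_of_comp_snd h).hasDerivAt.comp_hasFDerivAt z
    (hasFDerivAt_snd (𝕜 := ℝ) (E := Euc N) (F := ℝ))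
  have h2 : fderiv ℝ (fun z : Euc N × ℝ => k z.2) z = _ := h1.fderiv
  rw [h2]; simp [mul_comm]

lemma fderiv_comp_fst_time {k : Euc N → ℝ} {z : Euc N × ℝ}
    (h : DifferentiableAt ℝ (fun z : Euc N × ℝ => k z.1) z) (c : ℝ) :
    fderiv ℝ (fun z : Euc N × ℝ => k z.1) z (0, c) = 0 := by
  have h1 : DifferentiableAt ℝ (fun x : Euc N => ((x, z.2) : Euc N × ℝ)) z.1 := by fun_prop
  have h2 : DifferentiableAt ℝ k z.1 :=
    DifferentiableAt.comp (f := fun x : Euc N => ((x, z.2) : Euc N × ℝ)) z.1 h h1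
  have h3 := h2.hasFDerivAt.comp z (hasFDerivAt_fst (𝕜 := ℝ) (E := Euc N) (F := ℝ))
  have h4 : fderiv ℝ (fun z : Euc N × ℝ => k z.1) z = _ := h3.fderiv
  rw [h4]; simp

lemma measurable_fderiv_apply (F : Euc N × ℝ → ℝ) (v : Euc N × ℝ) :
    Measurable fun z => fderiv ℝ F z v := measurable_fderiv_apply_const ℝ F v

lemma integrable_fderiv_apply {μ : Measure (Euc N × ℝ)} [IsFiniteMeasureOnCompacts μ]
    {F : Euc N × ℝ → ℝ} {K : ℝ≥0} (hF : LipschitzWith K F) (hc : HasCompactSupport F)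
    (v : Euc N × ℝ) : Integrable (fun z => fderiv ℝ F z v) μ := by
  refine integrable_of_bounded_of_support_subset (C := tsupport F)
    hc.isCompact.measure_lt_top.ne (measurable_fderiv_apply F v).aestronglyMeasurable
    (M := K * ‖v‖) ?_ ?_
  · intro z _
    exact ((fderiv ℝ F z).le_opNorm v).trans
      (mul_le_mul_of_nonneg_right (norm_fderiv_le_of_lipschitz ℝ hF) (norm_nonneg v))
  · intro z hz
    have : fderiv ℝ F z = 0 := by
      by_contra h
      exact hz (support_fderiv_subset ℝ h)
    rw [this]; simp

/-- The time derivative of a Lipschitz function with compact support in the slab has integral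
zero. -/
lemma integral_fderiv_time_eq_zero {a : Euc N → ℝ} (ha : Continuous a) {F : Euc N × ℝ → ℝ}
    {K : ℝ≥0} (hF : LipschitzWith K F) (hc : HasCompactSupport F) (hS : tsupport F ⊆ Sset N) :
    ∫ z, fderiv ℝ F z (0, 1) ∂ muS a = 0 := by
  have := isLocallyFiniteMeasure_muS ha
  have hint := integrable_fderiv_apply (μ := muS a) hF hc (0, 1)
  have hd : ∀ᵐ z ∂ muS a, DifferentiableAt ℝ F z :=
    (muS_absolutelyContinuous ha).ae_le (ae_restrict_of_ae hF.ae_differentiableAt)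
  unfold muS at hint hd ⊢
  rw [integral_prod _ hint]
  have hd' := Measure.ae_ae_of_ae_prod hd
  obtain ⟨R, hR⟩ := hc.isCompact.isBounded.subset_closedBall 0
  have hzero : ∀ z : Euc N × ℝ, z ∉ tsupport F → F z = 0 := fun z hz =>
    image_eq_zero_of_notMem_tsupport hz
  refine integral_eq_zero_of_ae ?_
  filter_upwards [hd'] with x hx
  have hk : LipschitzWith K (fun t => F (x, t)) := by
    intro t t'
    refine (hF (x, t) (x, t')).trans ?_
    simp [Prod.edist_eq]
  have h1 : ∫ t in Ioi (0 : ℝ), fderiv ℝ F (x, t) (0, 1) =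
      ∫ t in Ioi (0 : ℝ), deriv (fun t => F (x, t)) t := by
    refine integral_congr_ae ?_
    filter_upwards [hx] with t ht
    have hl : HasDerivAt (fun t : ℝ => ((x, t) : Euc N × ℝ)) (0, 1) t :=
      (hasDerivAt_const t x).prodMk (hasDerivAt_id t)
    exact (ht.hasFDerivAt.comp_hasDerivAt t hl).deriv.symm
  have hlarge : ∀ t, |R| < t → F (x, t) = 0 := by
    intro t ht
    apply hzero
    intro hmem
    have h2 := hR hmem
    rw [mem_closedBall, dist_zero_right] at h2
    have h3 : ‖t‖ ≤ ‖((x, t) : Euc N × ℝ)‖ := norm_snd_le (x, t)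
    have h4 := le_abs_self t
    have h5 := le_abs_self R
    rw [Real.norm_eq_abs] at h3
    linarith
  have h2 : ∫ t in Ioi (0 : ℝ), deriv (fun t => F (x, t)) t =
      ∫ t in Ioc (0 : ℝ) (|R| + 1), deriv (fun t => F (x, t)) t := by
    refine setIntegral_eq_of_subset_of_forall_sdiff_eq_zero measurableSet_Ioi
      Ioc_subset_Ioi_self ?_
    rintro t ⟨ht0, ht⟩
    have ht' : |R| < t := by
      by_contra! h
      exact ht ⟨ht0, by linarith⟩
    have : (fun t => F (x, t)) =ᶠ[𝓝 t] fun _ => 0 := by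
      filter_upwards [isOpen_Ioi.mem_nhds ht'] with r hr using hlarge r hr
    rw [this.deriv_eq]; simp
  have hnn : (0 : ℝ) ≤ |R| + 1 := by positivity
  have h3 := (hk.lipschitzOnWith (s := uIcc 0 (|R| + 1))).absolutelyContinuousOnInterval.integral_deriv_eq_sub
  rw [intervalIntegral.integral_of_le hnn, hlarge _ (by linarith), hzero (x, 0)
    (fun h => absurd (hS h) (by simp [Sset]))] at h3
  simp only [Pi.zero_apply]
  rw [h1, h2, h3]; simp

end TestFunctions

section Multiplier

/-- The decreasing multiplier `1 + (κ / (κ + u)) ^ d`, with values in `[1, 2]` for `u ≥ 0`. -/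
def multiplier (d κ u : ℝ) : ℝ := 1 + κ ^ d * (κ + u) ^ (-d)

/-- The primitive of `multiplier` vanishing at `0`. -/
def multiplierPrimitive (d κ u : ℝ) : ℝ :=
  u + κ ^ d * (((κ + u) ^ (1 - d) - κ ^ (1 - d)) / (1 - d))

variable {d κ u : ℝ}

lemma hasDerivAt_multiplier (h : 0 < κ + u) :
    HasDerivAt (multiplier d κ) (-(d * κ ^ d * (κ + u) ^ (-d - 1))) u := by
  have h1 : HasDerivAt (fun u : ℝ => κ + u) 1 u := (hasDerivAt_id u).const_add κ
  have h2 := ((h1.rpow_const (p := -d) (Or.inl h.ne')).const_mul (κ ^ d)).const_add 1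
  have h3 : HasDerivAt (multiplier d κ) _ u := h2
  convert h3 using 1
  ring

lemma hasDerivAt_multiplierPrimitive (hd : d < 1) (h : 0 < κ + u) :
    HasDerivAt (multiplierPrimitive d κ) (multiplier d κ u) u := by
  have h1 : HasDerivAt (fun u : ℝ => κ + u) 1 u := (hasDerivAt_id u).const_add κ
  have h2 := (hasDerivAt_id u).add ((((h1.rpow_const (p := 1 - d) (Or.inl h.ne')).sub_const
    (κ ^ (1 - d))).div_const (1 - d)).const_mul (κ ^ d))
  have hd' : 1 - d ≠ 0 := by linarith
  have h3 : HasDerivAt (multiplierPrimitive d κ) _ u := h2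
  convert h3 using 1
  rw [multiplier, show 1 - d - 1 = -d by ring]
  field_simp

lemma one_le_multiplier (hκ : 0 < κ) (hu : 0 ≤ u) : 1 ≤ multiplier d κ u := by
  unfold multiplier; have : 0 < κ + u := by linarith
  have : 0 ≤ κ ^ d * (κ + u) ^ (-d) := by positivity
  linarith

lemma multiplier_le_two (hd : 0 ≤ d) (hκ : 0 < κ) (hu : 0 ≤ u) : multiplier d κ u ≤ 2 := by
  unfold multiplier
  have h1 : (κ + u) ^ (-d) ≤ κ ^ (-d) :=
    Real.rpow_le_rpow_of_nonpos hκ (by linarith) (by linarith)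
  have h2 : κ ^ d * (κ + u) ^ (-d) ≤ κ ^ d * κ ^ (-d) := by gcongr
  rw [← Real.rpow_add hκ] at h2
  simp at h2; linarith

lemma contDiffAt_multiplier (h : 0 < κ + u) : ContDiffAt ℝ 1 (multiplier d κ) u := by
  unfold multiplier
  have : ContDiffAt ℝ 1 (fun u : ℝ => (κ + u) ^ (-d)) u :=
    (contDiffAt_const.add contDiffAt_id).rpow_const_of_ne h.ne'
  exact contDiffAt_const.add (contDiffAt_const.mul this)

lemma contDiffAt_multiplierPrimitive (h : 0 < κ + u) :
    ContDiffAt ℝ 1 (multiplierPrimitive d κ) u := by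
  unfold multiplierPrimitive
  have : ContDiffAt ℝ 1 (fun u : ℝ => (κ + u) ^ (1 - d)) u :=
    (contDiffAt_const.add contDiffAt_id).rpow_const_of_ne h.ne'
  exact contDiffAt_id.add (contDiffAt_const.mul ((this.sub contDiffAt_const).div_const _))

lemma multiplierPrimitive_zero : multiplierPrimitive d κ 0 = 0 := by simp [multiplierPrimitive]

lemma multiplierPrimitive_mem_Icc (hd : 0 ≤ d) (hd1 : d < 1) (hκ : 0 < κ) (hu : 0 ≤ u) :
    multiplierPrimitive d κ u ∈ Icc 0 (2 * u) := by
  have hder : ∀ x ∈ Ici (0 : ℝ), HasDerivAt (multiplierPrimitive d κ) (multiplier d κ x) x :=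
    fun x hx => hasDerivAt_multiplierPrimitive hd1 (by have : 0 ≤ x := hx; linarith)
  have hcont : ContinuousOn (multiplierPrimitive d κ) (Ici 0) :=
    fun x hx => (hder x hx).continuousAt.continuousWithinAt
  constructor
  · have hm : MonotoneOn (multiplierPrimitive d κ) (Ici 0) := by
      refine monotoneOn_of_deriv_nonneg (convex_Ici 0) hcont ?_ ?_
      · intro x hx
        exact (hder x (interior_subset hx)).differentiableAt.differentiableWithinAt
      · intro x hx
        rw [(hder x (interior_subset hx)).deriv]
        linarith [one_le_multiplier (d := d) hκ (interior_subset hx : (0 : ℝ) ≤ x)]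
    simpa [multiplierPrimitive_zero] using hm (by simp) hu hu
  · have hder2 : ∀ x ∈ Ici (0 : ℝ), HasDerivAt (fun x => 2 * x - multiplierPrimitive d κ x)
        (2 * 1 - multiplier d κ x) x :=
      fun x hx => ((hasDerivAt_id x).const_mul 2).sub (hder x hx)
    have hm : MonotoneOn (fun x => 2 * x - multiplierPrimitive d κ x) (Ici 0) := by
      refine monotoneOn_of_deriv_nonneg (convex_Ici 0)
        (fun x hx => (hder2 x hx).continuousAt.continuousWithinAt) ?_ ?_
      · intro x hx
        exact (hder2 x (interior_subset hx)).differentiableAt.differentiableWithinAt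
      · intro x hx
        rw [(hder2 x (interior_subset hx)).deriv]
        linarith [multiplier_le_two hd hκ (interior_subset hx : (0 : ℝ) ≤ x)]
    have := hm (by simp) hu hu
    simp only [multiplierPrimitive_zero] at this
    linarith

end Multiplier

section Scalar

lemma flux_scalar_le {p s m K φ e X y u η D F : ℝ} (hp : 1 < p) (hs : p < s)
    (hφ : 0 ≤ φ) (he : 0 < e) (hX : 0 ≤ X) (hy : 0 ≤ y) (hu : 0 ≤ u) (hη1 : 1 ≤ η) (hη2 : η ≤ 2)
    (hD : |D| ≤ X * y) (hF0 : 0 ≤ F) (hFK : F ≤ K) :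
    (s * φ ^ (s - 1) * η * D - φ ^ s * e * y ^ 2) * u ^ (m - 1) * y ^ (p - 2) * F ≤
      K * (2 * s) ^ p * φ ^ (s - p) * X ^ p * e ^ (1 - p) * u ^ (m - 1) := by
  have hK : 0 ≤ K := hF0.trans hFK
  have hs0 : 0 < s := by linarith
  have hR : 0 ≤ (2 * s) ^ p * φ ^ (s - p) * X ^ p * e ^ (1 - p) := by positivity
  have hum : 0 ≤ u ^ (m - 1) := by positivity
  suffices h : (s * φ ^ (s - 1) * η * D - φ ^ s * e * y ^ 2) * y ^ (p - 2) ≤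
      (2 * s) ^ p * φ ^ (s - p) * X ^ p * e ^ (1 - p) by
    calc _ = ((s * φ ^ (s - 1) * η * D - φ ^ s * e * y ^ 2) * y ^ (p - 2)) *
          (F * u ^ (m - 1)) := by ring
      _ ≤ ((2 * s) ^ p * φ ^ (s - p) * X ^ p * e ^ (1 - p)) * (F * u ^ (m - 1)) := by gcongr
      _ ≤ ((2 * s) ^ p * φ ^ (s - p) * X ^ p * e ^ (1 - p)) * (K * u ^ (m - 1)) := by gcongr
      _ = _ := by ring
  rcases hy.eq_or_lt with rfl | hy
  · have : D = 0 := by simpa using hD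
    subst this
    simpa using hR
  rcases hφ.eq_or_lt with rfl | hφ
  · rw [Real.zero_rpow (by linarith), Real.zero_rpow (by linarith)]
    simp only [mul_zero, zero_mul, sub_zero]
    rw [Real.zero_rpow (by linarith)] at hR
    simp only [mul_zero, zero_mul] at hR
    rw [Real.zero_rpow (by linarith)]; simp
  have hyp : 0 < y ^ (p - 2) := by positivity
  have e1 : φ ^ s = φ ^ (s - 1) * φ := by
    rw [← Real.rpow_add_one hφ.ne']; ring_nf
  have h1 : s * φ ^ (s - 1) * η * D ≤ φ ^ (s - 1) * (2 * s * X) * y := by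
    have : η * D ≤ 2 * (X * y) := by
      have h2 := le_abs_self D
      have h3 := abs_nonneg D
      nlinarith
    calc s * φ ^ (s - 1) * η * D = s * φ ^ (s - 1) * (η * D) := by ring
      _ ≤ s * φ ^ (s - 1) * (2 * (X * y)) := by gcongr
      _ = _ := by ring
  have h2 : (s * φ ^ (s - 1) * η * D - φ ^ s * e * y ^ 2) ≤
      φ ^ (s - 1) * y * (2 * s * X - φ * e * y) := by
    rw [e1]; nlinarith
  rcases le_or_gt (2 * s * X) (φ * e * y) with hc | hc
  · have h3 : φ ^ (s - 1) * y * (2 * s * X - φ * e * y) ≤ 0 :=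
      mul_nonpos_of_nonneg_of_nonpos (by positivity) (by linarith)
    have h4 : (s * φ ^ (s - 1) * η * D - φ ^ s * e * y ^ 2) * y ^ (p - 2) ≤ 0 :=
      mul_nonpos_of_nonpos_of_nonneg (h2.trans h3) hyp.le
    linarith
  · have hX' : 0 < X := by
      by_contra! h
      have : X = 0 := le_antisymm h hX
      rw [this] at hc
      have : 0 < φ * e * y := by positivity
      linarith
    have h3 : y ≤ (2 * s * X) / (φ * e) := by
      rw [le_div_iff₀ (by positivity)]; linarith
    have h5 : y * y ^ (p - 2) = y ^ (p - 1) := by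
      rw [mul_comm, ← Real.rpow_add_one hy.ne']; ring_nf
    have h4 : y ^ (p - 1) ≤ ((2 * s * X) / (φ * e)) ^ (p - 1) :=
      Real.rpow_le_rpow hy.le h3 (by linarith)
    calc _ ≤ φ ^ (s - 1) * y * (2 * s * X - φ * e * y) * y ^ (p - 2) := by gcongr
      _ ≤ φ ^ (s - 1) * y * (2 * s * X) * y ^ (p - 2) := by
          gcongr
          have : 0 < φ * e * y := by positivity
          linarith
      _ = φ ^ (s - 1) * (2 * s * X) * y ^ (p - 1) := by rw [← h5]; ring
      _ ≤ φ ^ (s - 1) * (2 * s * X) * ((2 * s * X) / (φ * e)) ^ (p - 1) := by gcongr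
      _ = _ := by
          rw [Real.div_rpow (by positivity) (by positivity), Real.mul_rpow hφ.le he.le,
            show s - 1 = (s - p) + (p - 1) by ring, Real.rpow_add hφ,
            show 1 - p = -(p - 1) by ring, Real.rpow_neg he.le]
          have e2 : (2 * s) ^ p * X ^ p = (2 * s * X) * (2 * s * X) ^ (p - 1) := by
            rw [← Real.mul_rpow (by positivity) hX, mul_comm (2 * s * X) (_ ^ _),
              ← Real.rpow_add_one (by positivity)]
            ring_nf
          have hne : φ ^ (p - 1) ≠ 0 := by positivity
          have hne' : e ^ (p - 1) ≠ 0 := by positivity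
          field_simp
          rw [mul_comm s 2, e2]

end Scalar

section TestInequality

variable {N : ℕ}

/-- The norm of the spatial differential of `φ`. -/
def spaceSlope (φ : Euc N × ℝ → ℝ) (z : Euc N × ℝ) : ℝ :=
  ‖(fderiv ℝ φ z).comp (ContinuousLinearMap.inl ℝ (Euc N) ℝ)‖

/-- The absolute value of the time derivative of `φ`. -/
def timeSlope (φ : Euc N × ℝ → ℝ) (z : Euc N × ℝ) : ℝ := |fderiv ℝ φ z (0, 1)|

lemma spaceSlope_nonneg (φ : Euc N × ℝ → ℝ) (z : Euc N × ℝ) : 0 ≤ spaceSlope φ z :=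
  norm_nonneg _

lemma timeSlope_nonneg (φ : Euc N × ℝ → ℝ) (z : Euc N × ℝ) : 0 ≤ timeSlope φ z :=
  abs_nonneg _

lemma measurable_spaceSlope (φ : Euc N × ℝ → ℝ) : Measurable (spaceSlope φ) := by
  have h : Continuous fun l : (Euc N × ℝ) →L[ℝ] ℝ =>
      ‖l.comp (ContinuousLinearMap.inl ℝ (Euc N) ℝ)‖ := by fun_prop
  exact h.measurable.comp (measurable_fderiv ℝ φ)

lemma measurable_timeSlope (φ : Euc N × ℝ → ℝ) : Measurable (timeSlope φ) :=
  (measurable_fderiv_apply φ (0, 1)).norm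

lemma spaceSlope_le {φ : Euc N × ℝ → ℝ} {L : ℝ≥0} (hφ : LipschitzWith L φ) (z : Euc N × ℝ) :
    spaceSlope φ z ≤ L := by
  refine (ContinuousLinearMap.opNorm_comp_le _ _).trans ?_
  calc _ ≤ (L : ℝ) * 1 := mul_le_mul (norm_fderiv_le_of_lipschitz ℝ hφ)
        (ContinuousLinearMap.norm_inl_le_one ℝ (Euc N) ℝ) (norm_nonneg _) L.2
    _ = L := mul_one _

lemma timeSlope_le {φ : Euc N × ℝ → ℝ} {L : ℝ≥0} (hφ : LipschitzWith L φ) (z : Euc N × ℝ) :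
    timeSlope φ z ≤ L := by
  refine ((fderiv ℝ φ z).le_opNorm (0, 1)).trans ?_
  have h1 : ‖((0 : Euc N), (1 : ℝ))‖ = 1 := by simp [Prod.norm_def]
  rw [h1, mul_one]
  exact norm_fderiv_le_of_lipschitz ℝ hφ

lemma abs_fderiv_space_le (φ : Euc N × ℝ → ℝ) (z : Euc N × ℝ) (w : Euc N) :
    |fderiv ℝ φ z (w, 0)| ≤ spaceSlope φ z * ‖w‖ := by
  have := ((fderiv ℝ φ z).comp (ContinuousLinearMap.inl ℝ (Euc N) ℝ)).le_opNorm w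
  simpa [spaceSlope] using this

variable {β : ℝ}

lemma chi_nonneg (β t : ℝ) : 0 ≤ chi β t := by unfold chi; positivity

lemma chi_le_one (β t : ℝ) : chi β t ≤ 1 := min_le_left _ _

lemma chi_eq_zero (hβ : 0 < β) {t : ℝ} (ht : t ≤ β) : chi β t = 0 := by
  have : t / β - 1 ≤ 0 := by
    rw [sub_nonpos]; exact (div_le_one hβ).2 ht
  unfold chi
  rw [max_eq_left this]; norm_num

lemma chi_eq_one (hβ : 0 < β) {t : ℝ} (ht : 2 * β ≤ t) : chi β t = 1 := by
  have : 1 ≤ t / β - 1 := by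
    rw [le_sub_iff_add_le, le_div_iff₀ hβ]; linarith
  unfold chi
  exact min_eq_left (this.trans (le_max_right _ _))

lemma monotone_chi (hβ : 0 < β) : Monotone (chi β) := by
  intro s t hst
  unfold chi
  gcongr

lemma lipschitzWith_chi (β : ℝ) : ∃ L, LipschitzWith L (chi β) := by
  have h1 : LipschitzWith (‖β⁻¹‖₊) (fun t : ℝ => t / β - 1) := by
    refine LipschitzWith.of_dist_le_mul fun x y => le_of_eq ?_
    rw [Real.dist_eq, Real.dist_eq, coe_nnnorm, Real.norm_eq_abs, ← abs_mul]
    ring_nf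
  exact ⟨_, (h1.const_max 0).const_min 1⟩

lemma lipschitzWith_chi_snd (β : ℝ) : ∃ L, LipschitzWith L (fun z : Euc N × ℝ => chi β z.2) := by
  obtain ⟨L, hL⟩ := lipschitzWith_chi β
  exact ⟨_, hL.comp LipschitzWith.prod_snd⟩

lemma continuous_chi (β : ℝ) : Continuous (chi β) := (lipschitzWith_chi β).choose_spec.continuous

/-- The majorant of the gradient and time terms in the weak inequality. -/
def errorTerm (p K s d κ γ β : ℝ) (φ u : Euc N × ℝ → ℝ) (z : Euc N × ℝ) : ℝ :=
  chi β z.2 * (K * (2 * s) ^ p * φ z ^ (s - p) * spaceSlope φ z ^ p *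
    ((d * κ ^ d) ^ (1 - p) * (κ + u z) ^ γ) + 2 * s * φ z ^ (s - 1) * timeSlope φ z * u z)

end TestInequality

section CutoffTest

variable {N : ℕ} {β s ρ τ : ℝ} {φ w : Euc N × ℝ → ℝ} {L : ℝ≥0}

lemma isCompact_cylinder (ρ β τ : ℝ) :
    IsCompact (closedBall (0 : Euc N) ρ ×ˢ Icc β τ) :=
  (isCompact_closedBall 0 ρ).prod isCompact_Icc

lemma cylinder_subset_Sset (hβ : 0 < β) : closedBall (0 : Euc N) ρ ×ˢ Icc β τ ⊆ Sset N :=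
  fun _ hz => hβ.trans_le hz.2.1

lemma cutoff_eq_zero (hβ : 0 < β) (hs : 0 < s) (hφs : ∀ z, φ z ≠ 0 → ‖z.1‖ ≤ ρ ∧ z.2 ≤ τ)
    {z : Euc N × ℝ} (hz : z ∉ closedBall (0 : Euc N) ρ ×ˢ Icc β τ) :
    chi β z.2 * φ z ^ s = 0 := by
  by_cases h : φ z = 0
  · rw [h, zero_rpow hs.ne', mul_zero]
  · have h1 := hφs z h
    have h2 : z.2 ≤ β := by
      by_contra! h3
      exact hz ⟨by simpa using h1.1, h3.le, h1.2⟩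
    rw [chi_eq_zero hβ h2, zero_mul]

lemma tsupport_cutoff_mul_subset (hβ : 0 < β) (hs : 0 < s)
    (hφs : ∀ z, φ z ≠ 0 → ‖z.1‖ ≤ ρ ∧ z.2 ≤ τ) :
    tsupport (fun z => chi β z.2 * φ z ^ s * w z) ⊆ closedBall (0 : Euc N) ρ ×ˢ Icc β τ := by
  refine closure_minimal ?_ (isCompact_cylinder ρ β τ).isClosed
  intro z hz
  by_contra h
  exact hz (by simp only [cutoff_eq_zero hβ hs hφs h, zero_mul])

lemma hasCompactSupport_cutoff_mul (hβ : 0 < β) (hs : 0 < s)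
    (hφs : ∀ z, φ z ≠ 0 → ‖z.1‖ ≤ ρ ∧ z.2 ≤ τ) :
    HasCompactSupport (fun z => chi β z.2 * φ z ^ s * w z) :=
  (isCompact_cylinder ρ β τ).of_isClosed_subset (isClosed_tsupport _)
    (tsupport_cutoff_mul_subset hβ hs hφs)

lemma rpow_lipNear (hφL : LipschitzWith L φ) (hs : 1 ≤ s) (z : Euc N × ℝ) :
    LipNear (fun z => φ z ^ s) z :=
  (hφL.lipNear z).comp (H := fun x => x ^ s) (contDiffAt_rpow_const_of_le (by simpa using hs))

lemma locallyLipschitz_cutoff_mul (hφL : LipschitzWith L φ) (hβ : 0 < β) (hs : 1 ≤ s)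
    (hw : ∀ z ∈ Sset N, LipNear w z) :
    LocallyLipschitz (fun z => chi β z.2 * φ z ^ s * w z) := by
  rw [locallyLipschitz_iff_lipNear]
  intro z
  by_cases hz : z ∈ Sset N
  · obtain ⟨L', hL'⟩ := lipschitzWith_chi_snd (N := N) β
    exact ((hL'.lipNear z).mul (rpow_lipNear hφL hs z)).mul (hw z hz)
  · have hz' : z.2 < β := lt_of_le_of_lt (not_lt.1 hz) hβ
    refine ((LipschitzWith.const (α := Euc N × ℝ) (0 : ℝ)).lipNear z).congr ?_
    filter_upwards [(isOpen_lt continuous_snd continuous_const).mem_nhds hz'] with y hy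
    rw [chi_eq_zero hβ (le_of_lt hy)]; simp

end CutoffTest

section CoreInequality

variable {N : ℕ} {p m q K d κ β s ρ τ : ℝ} {V : Euc N × ℝ → ℝ} {f : ℝ → ℝ} {a : Euc N → ℝ}
  {u : Euc N × ℝ → ℝ} {gu : Euc N × ℝ → Euc N} {ut : Euc N × ℝ → ℝ} {φ : Euc N × ℝ → ℝ} {L : ℝ≥0}

lemma aestronglyMeasurable_of_locallyLipschitzOn (ha : Continuous a)
    (hu : LocallyLipschitzOn (Sset N) u) : AEStronglyMeasurable u (muS a) := by
  have h1 : (muS a).restrict (Sset N) = muS a :=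
    Measure.restrict_eq_self_of_ae_mem (ae_muS_mem_Sset ha)
  rw [← h1]
  exact hu.continuousOn.aestronglyMeasurable isOpen_Sset.measurableSet

lemma errorTerm_nonneg {γ : ℝ} (hK : 0 ≤ K) (hs : 0 ≤ s) (hd : 0 < d) (hκ : 0 < κ)
    {z : Euc N × ℝ} (hφ : 0 ≤ φ z) (hu : 0 ≤ u z) : 0 ≤ errorTerm p K s d κ γ β φ u z := by
  have h1 := chi_nonneg β z.2
  have h2 := spaceSlope_nonneg φ z
  have h3 := timeSlope_nonneg φ z
  unfold errorTerm
  positivity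

lemma integrable_errorTerm {γ : ℝ} (hp : 1 < p) (ha : Continuous a) (hK : 0 ≤ K)
    (hu0 : ∀ z ∈ Sset N, 0 ≤ u z) (huL : LocallyLipschitzOn (Sset N) u)
    (hφL : LipschitzWith L φ) (hφ0 : ∀ z, 0 ≤ φ z) (hφ1 : ∀ z, φ z ≤ 1)
    (hφs : ∀ z, φ z ≠ 0 → ‖z.1‖ ≤ ρ ∧ z.2 ≤ τ) (hβ : 0 < β) (hs : p < s)
    (hd0 : 0 < d) (hκ : 0 < κ) (hγ : 0 ≤ γ) :
    Integrable (errorTerm p K s d κ γ β φ u) (muS a) := by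
  have := isLocallyFiniteMeasure_muS ha
  have hS := cylinder_subset_Sset (N := N) (ρ := ρ) (τ := τ) hβ
  obtain ⟨M, hM⟩ := (isCompact_cylinder (N := N) ρ β τ).exists_bound_of_continuousOn
    (huL.continuousOn.mono hS)
  refine integrable_of_bounded_of_support_subset (C := closedBall (0 : Euc N) ρ ×ˢ Icc β τ)
    (isCompact_cylinder ρ β τ).measure_lt_top.ne ?_
    (M := 1 * (K * (2 * s) ^ p * 1 * (L : ℝ) ^ p * ((d * κ ^ d) ^ (1 - p) * (κ + M) ^ γ) +
      2 * s * 1 * L * M)) ?_ ?_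
  · have hum := (aestronglyMeasurable_of_locallyLipschitzOn ha huL).aemeasurable
    have h1 : AEMeasurable (fun z : Euc N × ℝ => chi β z.2) (muS a) :=
      ((continuous_chi β).comp continuous_snd).measurable.aemeasurable
    have h2 := hφL.continuous.measurable.aemeasurable (μ := muS a)
    have h3 := (measurable_spaceSlope φ).aemeasurable (μ := muS a)
    have h4 := (measurable_timeSlope φ).aemeasurable (μ := muS a)
    refine AEMeasurable.aestronglyMeasurable ?_
    unfold errorTerm
    fun_prop
  · intro z hz
    have hu := hu0 z (hS hz)
    have huM : u z ≤ M := (le_abs_self _).trans (hM z hz)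
    have h0 := errorTerm_nonneg (p := p) (γ := γ) (β := β) hK (by linarith : 0 ≤ s) hd0 hκ (hφ0 z) hu
    rw [abs_of_nonneg h0]
    have h1 := chi_nonneg β z.2
    have h2 := spaceSlope_nonneg φ z
    have h3 := timeSlope_nonneg φ z
    have h4 := hφ0 z
    have hs0 : 0 ≤ s := by linarith
    unfold errorTerm
    gcongr
    · exact chi_le_one _ _
    · exact rpow_le_one h4 (hφ1 z) (by linarith)
    · exact spaceSlope_le hφL z
    · exact rpow_le_one h4 (hφ1 z) (by linarith)
    · exact timeSlope_le hφL z
  · intro z hz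
    have h1 := cutoff_eq_zero hβ (by linarith : 0 < s - p) hφs hz
    have h2 := cutoff_eq_zero hβ (by linarith : 0 < s - 1) hφs hz
    unfold errorTerm
    linear_combination (K * (2 * s) ^ p * spaceSlope φ z ^ p *
      ((d * κ ^ d) ^ (1 - p) * (κ + u z) ^ γ)) * h1 + 2 * s * timeSlope φ z * u z * h2

end CoreInequality

section WeakInequality

variable {N : ℕ} {p m q K d κ β s ρ τ : ℝ} {V : Euc N × ℝ → ℝ} {f : ℝ → ℝ} {a : Euc N → ℝ}
  {u : Euc N × ℝ → ℝ} {gu : Euc N × ℝ → Euc N} {ut : Euc N × ℝ → ℝ} {φ : Euc N × ℝ → ℝ} {L : ℝ≥0}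

lemma fderiv_cutoff_mul {w : Euc N × ℝ → ℝ} {w' : (Euc N × ℝ) →L[ℝ] ℝ} {z : Euc N × ℝ}
    (hs : 1 ≤ s) (hc : DifferentiableAt ℝ (fun z : Euc N × ℝ => chi β z.2) z)
    (hφ : DifferentiableAt ℝ φ z) (hw : HasFDerivAt w w' z) (v : Euc N × ℝ) :
    fderiv ℝ (fun z => chi β z.2 * φ z ^ s * w z) z v =
      chi β z.2 * φ z ^ s * w' v + w z * (φ z ^ s * (v.2 * deriv (chi β) z.2) +
        chi β z.2 * (s * φ z ^ (s - 1) * fderiv ℝ φ z v)) := by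
  have h1 := (hc.hasFDerivAt.mul (hφ.hasFDerivAt.rpow_const (p := s) (Or.inr hs))).mul hw
  have h2 : fderiv ℝ (fun z => chi β z.2 * φ z ^ s * w z) z = _ := h1.fderiv
  rw [h2]
  simp only [add_apply, smul_apply, smul_eq_mul, fderiv_comp_snd hc, Pi.mul_apply]
  ring

lemma multiplier_flux_rpow_le {γ u : ℝ} (hm : 1 ≤ m) (hκ : 0 < κ) (hd : 0 < d)
    (hu : 0 ≤ u) (hγ : γ = p + m - 2 + d * (p - 1)) :
    (d * κ ^ d * (κ + u) ^ (-d - 1)) ^ (1 - p) * u ^ (m - 1) ≤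
      (d * κ ^ d) ^ (1 - p) * (κ + u) ^ γ := by
  have h0 : 0 < κ + u := by linarith
  rw [mul_rpow (by positivity) (by positivity), ← rpow_mul h0.le]
  calc _ ≤ (d * κ ^ d) ^ (1 - p) * (κ + u) ^ ((-d - 1) * (1 - p)) * (κ + u) ^ (m - 1) := by
        gcongr
        linarith
    _ = _ := by
        rw [mul_assoc, ← rpow_add h0, hγ]
        ring_nf

lemma flux_le_errorTerm (hp : 1 < p) (hm : 1 ≤ m) (hs : p < s) (hd0 : 0 < d) (hd1 : d < 1)
    (hκ : 0 < κ) (hf : ∀ r : ℝ, 0 ≤ r → 0 ≤ f r ∧ f r ≤ K) {z : Euc N × ℝ} (hu0 : 0 ≤ u z)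
    (hφ0 : 0 ≤ φ z) (hc : DifferentiableAt ℝ (fun z : Euc N × ℝ => chi β z.2) z)
    (hφ : DifferentiableAt ℝ φ z) (hu : HasFDerivAt u (pairCLM (gu z) (ut z)) z) :
    fderiv ℝ (fun z => chi β z.2 * φ z ^ s * multiplier d κ (u z)) z (gu z, 0) * u z ^ (m - 1) *
      ‖gu z‖ ^ (p - 2) * f ‖gu z‖ ≤
    chi β z.2 * (K * (2 * s) ^ p * φ z ^ (s - p) * spaceSlope φ z ^ p *
      ((d * κ ^ d) ^ (1 - p) * (κ + u z) ^ (p + m - 2 + d * (p - 1)))) := by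
  have h0 : 0 < κ + u z := by linarith
  have hw := (hasDerivAt_multiplier (d := d) h0).comp_hasFDerivAt z hu
  have hK : 0 ≤ K := (hf 0 le_rfl).1.trans (hf 0 le_rfl).2
  have hx := spaceSlope_nonneg φ z
  have e1 := fderiv_cutoff_mul (hp.le.trans hs.le) hc hφ hw (gu z, 0)
  simp only [Function.comp_def] at e1
  rw [e1]
  have h1 := flux_scalar_le (m := m) (K := K) (e := d * κ ^ d * (κ + u z) ^ (-d - 1)) hp hs hφ0
    (by positivity) hx (norm_nonneg (gu z)) hu0
    (one_le_multiplier (d := d) hκ hu0) (multiplier_le_two hd0.le hκ hu0)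
    (abs_fderiv_space_le φ z (gu z)) (hf ‖gu z‖ (norm_nonneg _)).1 (hf ‖gu z‖ (norm_nonneg _)).2
  have h2 := multiplier_flux_rpow_le hm hκ hd0 hu0 (rfl : p + m - 2 + d * (p - 1) = _)
  have h3 : pairCLM (gu z) (ut z) (gu z, 0) = ‖gu z‖ ^ 2 := by
    simp [pairCLM]
  have hs0 : 0 ≤ s := by linarith
  refine le_trans (le_of_eq ?_) (mul_le_mul_of_nonneg_left (h1.trans ?_) (chi_nonneg β z.2))
  · simp only [smul_apply, smul_eq_mul, h3]
    ring
  · calc _ = K * (2 * s) ^ p * φ z ^ (s - p) * spaceSlope φ z ^ p *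
          ((d * κ ^ d * (κ + u z) ^ (-d - 1)) ^ (1 - p) * u z ^ (m - 1)) := by ring
      _ ≤ _ := by gcongr

lemma time_le_errorTerm (hs : 1 ≤ s) (hd0 : 0 < d) (hd1 : d < 1) (hβ : 0 < β)
    (hκ : 0 < κ) {z : Euc N × ℝ} (hu0 : 0 ≤ u z)
    (hφ0 : 0 ≤ φ z) (hc : DifferentiableAt ℝ (fun z : Euc N × ℝ => chi β z.2) z)
    (hφ : DifferentiableAt ℝ φ z) {u' : (Euc N × ℝ) →L[ℝ] ℝ} (hu : HasFDerivAt u u' z) :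
    fderiv ℝ (fun z => chi β z.2 * φ z ^ s *
        (u z * multiplier d κ (u z) - multiplierPrimitive d κ (u z))) z (0, 1) -
      fderiv ℝ (fun z => chi β z.2 * φ z ^ s * multiplier d κ (u z)) z (0, 1) * u z ≤
    chi β z.2 * (2 * s * φ z ^ (s - 1) * timeSlope φ z * u z) := by
  have h0 : 0 < κ + u z := by linarith
  have hw := (hasDerivAt_multiplier (d := d) h0).comp_hasFDerivAt z hu
  have hG := (((hasDerivAt_id (u z)).mul (hasDerivAt_multiplier (d := d) h0)).sub
    (hasDerivAt_multiplierPrimitive hd1 h0)).comp_hasFDerivAt z hu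
  have e1 := fderiv_cutoff_mul hs hc hφ hw (0, 1)
  have e2 := fderiv_cutoff_mul hs hc hφ hG (0, 1)
  simp only [Function.comp_def, Pi.sub_apply, Pi.mul_apply, id, smul_apply, smul_eq_mul,
    one_mul] at e1 e2
  rw [e1, e2]
  obtain ⟨hΛ0, hΛ1⟩ := multiplierPrimitive_mem_Icc hd0.le hd1 hκ hu0
  have hchi := chi_nonneg β z.2
  have hder : 0 ≤ deriv (chi β) z.2 := (monotone_chi hβ).deriv_nonneg
  have hφ' : -timeSlope φ z ≤ fderiv ℝ φ z (0, 1) := neg_abs_le _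
  have hT := timeSlope_nonneg φ z
  have hs0 : 0 ≤ s := by linarith
  set Λ := multiplierPrimitive d κ (u z)
  calc _ = Λ * (chi β z.2 * (s * φ z ^ (s - 1)) * (-fderiv ℝ φ z (0, 1))) -
        Λ * (φ z ^ s * deriv (chi β) z.2) := by ring
    _ ≤ Λ * (chi β z.2 * (s * φ z ^ (s - 1)) * timeSlope φ z) - 0 := by
        gcongr
        · linarith
        · positivity
    _ ≤ 2 * u z * (chi β z.2 * (s * φ z ^ (s - 1)) * timeSlope φ z) - 0 := by gcongr
    _ = _ := by ring

end WeakInequality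

section IntegralInequality

variable {N : ℕ} {p m q K d κ β s ρ τ : ℝ} {V : Euc N × ℝ → ℝ} {f : ℝ → ℝ} {a : Euc N → ℝ}
  {u : Euc N × ℝ → ℝ} {gu : Euc N × ℝ → Euc N} {ut : Euc N × ℝ → ℝ} {φ : Euc N × ℝ → ℝ} {L : ℝ≥0}

lemma integrable_mul_of_continuousOn {μ : Measure (Euc N × ℝ)} {F G : Euc N × ℝ → ℝ}
    {C : Set (Euc N × ℝ)} (hC : IsCompact C) (hCS : C ⊆ Sset N) (hF : ContinuousOn F (Sset N))
    (hF0 : ∀ z, z ∉ C → F z = 0) (hG : LocallyIntegrableOn G (Sset N) μ) :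
    Integrable (fun z => F z * G z) μ := by
  rw [← integrableOn_iff_integrable_of_support_subset (s := C)]
  · exact (hG.integrableOn_compact_subset hCS hC).continuousOn_mul (hF.mono hCS) hC
  · intro z hz
    by_contra h
    exact hz (by simp only [hF0 z h, zero_mul])

lemma pairCLM_surjective (l : (Euc N × ℝ) →L[ℝ] ℝ) :
    pairCLM ((InnerProductSpace.toDual ℝ (Euc N)).symm
      (l.comp (ContinuousLinearMap.inl ℝ (Euc N) ℝ))) (l (0, 1)) = l := by
  ext v
  · simp [pairCLM]
  · simp [pairCLM]

/-- The weak inequality tested with a cutoff times the multiplier. -/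
theorem IsWeakSol.integral_le_errorTerm (hu : IsWeakSol N p m q V f a u gu ut)
    (hp : 1 < p) (hm : 1 ≤ m) (ha : Continuous a)
    (hf : ∀ r : ℝ, 0 ≤ r → 0 ≤ f r ∧ f r ≤ K) (hV : ∀ᵐ z ∂ muS a, 0 < V z)
    (hφL : LipschitzWith L φ) (hφ0 : ∀ z, 0 ≤ φ z) (hφ1 : ∀ z, φ z ≤ 1)
    (hφs : ∀ z, φ z ≠ 0 → ‖z.1‖ ≤ ρ ∧ z.2 ≤ τ) (hβ : 0 < β) (hs : p < s)
    (hd0 : 0 < d) (hd1 : d < 1) (hκ : 0 < κ) :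
    Integrable (fun z => chi β z.2 * φ z ^ s * (u z ^ q * V z)) (muS a) ∧
    Integrable (errorTerm p K s d κ (p + m - 2 + d * (p - 1)) β φ u) (muS a) ∧
    ∫ z, chi β z.2 * φ z ^ s * (u z ^ q * V z) ∂ muS a ≤
      ∫ z, errorTerm p K s d κ (p + m - 2 + d * (p - 1)) β φ u z ∂ muS a := by
  have := isLocallyFiniteMeasure_muS ha
  have hK : 0 ≤ K := (hf 0 le_rfl).1.trans (hf 0 le_rfl).2
  have hs1 : 1 ≤ s := by linarith
  have hs0 : 0 < s := by linarith
  have hγ : 0 ≤ p + m - 2 + d * (p - 1) := by nlinarith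
  have hSC := cylinder_subset_Sset (N := N) (ρ := ρ) (τ := τ) hβ
  have hCc := isCompact_cylinder (N := N) ρ β τ
  have hdom : ∀ z ∈ Sset N, 0 < κ + u z := fun z hz => by linarith [hu.nonneg z hz]
  have hcu := hu.locLip.continuousOn
  -- the test function
  set H : Euc N × ℝ → ℝ := fun z => multiplier d κ (u z) with hH
  set G₀ : Euc N × ℝ → ℝ := fun z => u z * multiplier d κ (u z) - multiplierPrimitive d κ (u z)
    with hG₀
  have hHL : ∀ z ∈ Sset N, LipNear H z := fun z hz =>
    (hu.locLip.lipNear isOpen_Sset hz).comp (contDiffAt_multiplier (hdom z hz))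
  have hGL : ∀ z ∈ Sset N, LipNear G₀ z := fun z hz =>
    (hu.locLip.lipNear isOpen_Sset hz).comp
      (H := fun r => r * multiplier d κ r - multiplierPrimitive d κ r)
      ((contDiffAt_id.mul (contDiffAt_multiplier (hdom z hz))).sub
        (contDiffAt_multiplierPrimitive (hdom z hz)))
  set ψ : Euc N × ℝ → ℝ := fun z => chi β z.2 * φ z ^ s * H z with hψ
  set G : Euc N × ℝ → ℝ := fun z => chi β z.2 * φ z ^ s * G₀ z with hG
  have hψl : LocallyLipschitz ψ := locallyLipschitz_cutoff_mul hφL hβ hs1 hHL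
  have hGl : LocallyLipschitz G := locallyLipschitz_cutoff_mul hφL hβ hs1 hGL
  have hψc : HasCompactSupport ψ := hasCompactSupport_cutoff_mul hβ hs0 hφs
  have hGc : HasCompactSupport G := hasCompactSupport_cutoff_mul hβ hs0 hφs
  have hψC : tsupport ψ ⊆ _ := tsupport_cutoff_mul_subset hβ hs0 hφs
  have hψS : tsupport ψ ⊆ Sset N := (tsupport_cutoff_mul_subset hβ hs0 hφs).trans hSC
  have hGS : tsupport G ⊆ Sset N := (tsupport_cutoff_mul_subset hβ hs0 hφs).trans hSC
  obtain ⟨Lψ, hLψ⟩ := hψl.exists_lipschitzWith hψc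
  obtain ⟨LG, hLG⟩ := hGl.exists_lipschitzWith hGc
  have hcut : ∀ z, z ∉ closedBall (0 : Euc N) ρ ×ˢ Icc β τ → chi β z.2 * φ z ^ s = 0 :=
    fun z hz => cutoff_eq_zero hβ hs0 hφs hz
  have hcutc : Continuous fun z : Euc N × ℝ => chi β z.2 * φ z ^ s :=
    ((continuous_chi β).comp continuous_snd).mul
      (hφL.continuous.rpow_const fun z => Or.inr hs0.le)
  -- almost everywhere facts
  have hS := ae_muS_mem_Sset ha
  have hac := muS_absolutelyContinuous ha
  obtain ⟨Lc, hLc⟩ := lipschitzWith_chi_snd (N := N) β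
  have hdc : ∀ᵐ z ∂ muS a, DifferentiableAt ℝ (fun z : Euc N × ℝ => chi β z.2) z :=
    hac.ae_le (ae_restrict_of_ae hLc.ae_differentiableAt)
  have hdφ : ∀ᵐ z ∂ muS a, DifferentiableAt ℝ φ z :=
    hac.ae_le (ae_restrict_of_ae hφL.ae_differentiableAt)
  have hdu : ∀ᵐ z ∂ muS a, DifferentiableAt ℝ u z :=
    hac.ae_le (ae_differentiableAt_of_locallyLipschitzOn isOpen_Sset hu.locLip)
  have hgu := hac.ae_le hu.deriv_ae
  -- the weak inequality
  have key := hu.weak_ineq ψ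
    (fun z => (InnerProductSpace.toDual ℝ (Euc N)).symm
      ((fderiv ℝ ψ z).comp (ContinuousLinearMap.inl ℝ (Euc N) ℝ)))
    (fun z => fderiv ℝ ψ z (0, 1)) ?_ hψl hψc hψS ?_
  rotate_left
  · intro z
    by_cases hz : z ∈ Sset N
    · have h1 : 1 ≤ H z := one_le_multiplier hκ (hu.nonneg z hz)
      have h2 := chi_nonneg β z.2
      have h3 := hφ0 z
      positivity
    · have h1 : chi β z.2 = 0 := chi_eq_zero hβ ((not_lt.1 hz).trans hβ.le)
      simp [hψ, h1]
  · refine ae_of_all _ fun z hz => ?_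
    rw [pairCLM_surjective]
    exact hz.hasFDerivAt
  have hintE := integrable_errorTerm (p := p) (γ := p + m - 2 + d * (p - 1)) hp ha hK hu.nonneg
    hu.locLip hφL hφ0 hφ1 hφs hβ hs hd0 hκ hγ
  have hintL : Integrable (fun z => chi β z.2 * φ z ^ s * (u z ^ q * V z)) (muS a) :=
    integrable_mul_of_continuousOn hCc hSC hcutc.continuousOn hcut hu.int_uqV
  refine ⟨hintL, hintE, ?_⟩
  -- the time term
  have hintt : Integrable (fun z => fderiv ℝ ψ z (0, 1) * u z) (muS a) := by
    have h1 := integrable_fderiv_apply (μ := muS a) hLψ hψc (0, 1)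
    rw [← integrableOn_iff_integrable_of_support_subset
      (s := closedBall (0 : Euc N) ρ ×ˢ Icc β τ)]
    · exact h1.integrableOn.mul_continuousOn (hcu.mono hSC) hCc
    · intro z hz
      by_contra h
      have : fderiv ℝ ψ z = 0 := by
        by_contra h'
        exact h (hψC (support_fderiv_subset ℝ h'))
      exact hz (by simp [this])
  have hintG := integrable_fderiv_apply (μ := muS a) hLG hGc (0, 1)
  have hG0 := integral_fderiv_time_eq_zero ha hLG hGc hGS
  have hintGt : Integrable (fun z => fderiv ℝ G z (0, 1) - fderiv ℝ ψ z (0, 1) * u z) (muS a) :=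
    hintG.sub hintt
  have htime : -∫ z, fderiv ℝ ψ z (0, 1) * u z ∂ muS a =
      ∫ z, (fderiv ℝ G z (0, 1) - fderiv ℝ ψ z (0, 1) * u z) ∂ muS a := by
    rw [integral_sub hintG hintt, hG0, zero_sub]
  -- the flux term
  set Fl : Euc N × ℝ → ℝ := fun z => fderiv ℝ ψ z (gu z, 0) * u z ^ (m - 1) *
      ‖gu z‖ ^ (p - 2) * f ‖gu z‖ with hFl
  have hflux : ∫ z, ⟪(InnerProductSpace.toDual ℝ (Euc N)).symm
      ((fderiv ℝ ψ z).comp (ContinuousLinearMap.inl ℝ (Euc N) ℝ)), gu z⟫ * u z ^ (m - 1) *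
      ‖gu z‖ ^ (p - 2) * f ‖gu z‖ ∂ muS a = ∫ z, Fl z ∂ muS a := by
    simp [hFl]
  have hpt : ∀ᵐ z ∂ muS a, Fl z + (fderiv ℝ G z (0, 1) - fderiv ℝ ψ z (0, 1) * u z) ≤
      errorTerm p K s d κ (p + m - 2 + d * (p - 1)) β φ u z ∧
      fderiv ℝ G z (0, 1) - fderiv ℝ ψ z (0, 1) * u z ≤
      errorTerm p K s d κ (p + m - 2 + d * (p - 1)) β φ u z := by
    filter_upwards [hS, hdc, hdφ, hdu, hgu] with z hzS hzc hzφ hzu hzg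
    have hz0 := hu.nonneg z hzS
    have h1 := flux_le_errorTerm hp hm hs hd0 hd1 hκ hf hz0 (hφ0 z) hzc hzφ (hzg hzu)
    have h2 := time_le_errorTerm hs1 hd0 hd1 hβ hκ hz0 (hφ0 z) hzc hzφ (hzg hzu)
    have h3 := spaceSlope_nonneg φ z
    have h4 := chi_nonneg β z.2
    have h5 := hφ0 z
    have h6 : 0 ≤ chi β z.2 * (K * (2 * s) ^ p * φ z ^ (s - p) * spaceSlope φ z ^ p *
      ((d * κ ^ d) ^ (1 - p) * (κ + u z) ^ (p + m - 2 + d * (p - 1)))) := by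
      have := hdom z hzS
      positivity
    rw [errorTerm, mul_add]
    exact ⟨add_le_add h1 h2, by linarith⟩
  have hright : (∫ z, Fl z ∂ muS a) +
      ∫ z, (fderiv ℝ G z (0, 1) - fderiv ℝ ψ z (0, 1) * u z) ∂ muS a ≤
      ∫ z, errorTerm p K s d κ (p + m - 2 + d * (p - 1)) β φ u z ∂ muS a := by
    by_cases hi : Integrable Fl (muS a)
    · rw [← integral_add hi hintGt]
      exact integral_mono_ae (hi.add hintGt) hintE (hpt.mono fun z hz => hz.1)
    · rw [integral_undef hi, zero_add]
      exact integral_mono_ae hintGt hintE (hpt.mono fun z hz => hz.2)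
  -- the potential term
  have hleft : ∫ z, chi β z.2 * φ z ^ s * (u z ^ q * V z) ∂ muS a ≤
      ∫ z, ψ z * u z ^ q * V z ∂ muS a := by
    refine integral_mono_ae hintL ?_ ?_
    · have h1 : Integrable (fun z => ψ z * (u z ^ q * V z)) (muS a) :=
        integrable_mul_of_continuousOn hCc hSC hψl.continuous.continuousOn
          (fun z hz => by simp only [hψ, hcut z hz, zero_mul]) hu.int_uqV
      simpa only [mul_assoc] using h1
    · filter_upwards [hS, hV] with z hzS hzV
      have h1 : 1 ≤ H z := one_le_multiplier hκ (hu.nonneg z hzS)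
      have h2 := chi_nonneg β z.2
      have h3 := hφ0 z
      have h4 := hu.nonneg z hzS
      calc _ = chi β z.2 * φ z ^ s * 1 * u z ^ q * V z := by ring
        _ ≤ _ := by simp only [hψ]; gcongr
  rw [hflux] at key
  linarith

end IntegralInequality

section Young

lemma weighted_young {b φ u v lam γ q e s : ℝ} (hb : 0 ≤ b) (hφ0 : 0 ≤ φ) (hφ1 : φ ≤ 1)
    (hu : 0 ≤ u) (hv : 0 < v) (hl : 0 < lam) (hγ : 0 < γ) (hγq : γ < q) (hes : e < s)
    (hs : e * (q / (q - γ)) ≤ s) :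
    b * φ ^ (s - e) * u ^ γ ≤
      lam * (φ ^ s * (u ^ q * v)) +
        lam ^ (-(γ / (q - γ))) * (b ^ (q / (q - γ)) * v ^ (-(γ / (q - γ)))) := by
  have hqγ : 0 < q - γ := by linarith
  have hr1 : 0 ≤ lam ^ (-(γ / (q - γ))) * (b ^ (q / (q - γ)) * v ^ (-(γ / (q - γ)))) := by
    positivity
  have hr2 : 0 ≤ lam * (φ ^ s * (u ^ q * v)) := by positivity
  rcases hφ0.eq_or_lt with rfl | hφ
  · rw [zero_rpow (by linarith)]
    simp only [mul_zero, zero_mul]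
    linarith
  by_cases hc : b * φ ^ (-e) ≤ lam * u ^ (q - γ) * v
  · refine le_trans ?_ (le_add_of_nonneg_right hr1)
    calc b * φ ^ (s - e) * u ^ γ = φ ^ s * u ^ γ * (b * φ ^ (-e)) := by
          rw [sub_eq_add_neg, rpow_add hφ]; ring
      _ ≤ φ ^ s * u ^ γ * (lam * u ^ (q - γ) * v) := by gcongr
      _ = lam * (φ ^ s * ((u ^ γ * u ^ (q - γ)) * v)) := by ring
      _ = _ := by rw [← rpow_add_of_nonneg hu hγ.le hqγ.le]; ring_nf
  · push Not at hc
    refine le_trans ?_ (le_add_of_nonneg_left hr2)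
    have h1 : u ^ (q - γ) ≤ b * φ ^ (-e) / (lam * v) := by
      rw [le_div_iff₀ (by positivity)]
      linarith
    have h2 : u ^ γ ≤ (b * φ ^ (-e) / (lam * v)) ^ (γ / (q - γ)) := by
      calc u ^ γ = (u ^ (q - γ)) ^ (γ / (q - γ)) := by
            rw [← rpow_mul hu]; congr 1; field_simp
        _ ≤ _ := by gcongr
    have h3 : (b * φ ^ (-e) / (lam * v)) ^ (γ / (q - γ)) =
        b ^ (γ / (q - γ)) * φ ^ (-e * (γ / (q - γ))) *
          (lam ^ (-(γ / (q - γ))) * v ^ (-(γ / (q - γ)))) := by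
      rw [div_rpow (by positivity) (by positivity), mul_rpow hb (by positivity),
        mul_rpow hl.le hv.le, ← rpow_mul hφ.le, rpow_neg hl.le, rpow_neg hv.le]
      field_simp
    have h4 : q / (q - γ) = 1 + γ / (q - γ) := by field_simp; ring
    have h5 : φ ^ (s - e) * φ ^ (-e * (γ / (q - γ))) ≤ 1 := by
      rw [← rpow_add hφ]
      refine rpow_le_one hφ.le hφ1 ?_
      rw [h4] at hs
      linarith
    have h6 : b * b ^ (γ / (q - γ)) = b ^ (q / (q - γ)) := by
      rw [h4, rpow_add_of_nonneg hb zero_le_one (by positivity), rpow_one]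
    calc b * φ ^ (s - e) * u ^ γ ≤ b * φ ^ (s - e) * (b ^ (γ / (q - γ)) *
          φ ^ (-e * (γ / (q - γ))) * (lam ^ (-(γ / (q - γ))) * v ^ (-(γ / (q - γ))))) := by
          rw [← h3]; gcongr
      _ = (φ ^ (s - e) * φ ^ (-e * (γ / (q - γ)))) * ((b * b ^ (γ / (q - γ))) *
          (lam ^ (-(γ / (q - γ))) * v ^ (-(γ / (q - γ))))) := by ring
      _ ≤ 1 * ((b * b ^ (γ / (q - γ))) *
          (lam ^ (-(γ / (q - γ))) * v ^ (-(γ / (q - γ))))) := by gcongr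
      _ = _ := by rw [h6]; ring

lemma rpow_neg_le_add {lam x lo hi : ℝ} (hl : 0 < lam) (hlo : lo ≤ x) (hhi : x ≤ hi) :
    lam ^ (-x) ≤ lam ^ (-lo) + lam ^ (-hi) := by
  have h1 : 0 < lam ^ (-lo) := by positivity
  have h2 : 0 < lam ^ (-hi) := by positivity
  rcases le_total 1 lam with h | h
  · have := rpow_le_rpow_of_exponent_le h (neg_le_neg hlo)
    linarith
  · have := rpow_le_rpow_of_exponent_ge hl h (neg_le_neg hhi)
    linarith

lemma add_rpow_le_two_rpow_mul {x y γ : ℝ} (hx : 0 ≤ x) (hy : 0 ≤ y) (hγ : 0 ≤ γ) :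
    (x + y) ^ γ ≤ 2 ^ γ * (x ^ γ + y ^ γ) := by
  have h1 : 0 ≤ x ^ γ := by positivity
  have h2 : 0 ≤ y ^ γ := by positivity
  have key : ∀ z : ℝ, 0 ≤ z → x + y ≤ 2 * z → (x + y) ^ γ ≤ 2 ^ γ * z ^ γ := fun z hz h => by
    rw [← mul_rpow two_pos.le hz]
    exact rpow_le_rpow (by positivity) h hγ
  have h3 : (0 : ℝ) < 2 ^ γ := by positivity
  rcases le_total x y with h | h
  · exact (key y hy (by linarith)).trans (by nlinarith)
  · exact (key x hx (by linarith)).trans (by nlinarith)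

end Young

section ShellBounds

lemma rpow_lower_scale {L x w b : ℝ} (hb : 0 ≤ b) (hw : 0 < w) (h : w ≤ 2 ^ (L * x)) :
    (2 : ℝ) ^ (-(L * x * b)) ≤ w ^ (-b) := by
  calc (2 : ℝ) ^ (-(L * x * b)) = (2 ^ (L * x)) ^ (-b) := by
        rw [← rpow_mul two_pos.le]; ring_nf
    _ ≤ w ^ (-b) := rpow_le_rpow_of_nonpos hw h (by linarith)

lemma rpow_upper_scale {L x w b : ℝ} (hb : 0 ≤ b) (h : 2 ^ (-(L * x)) ≤ w) :
    w ^ (-b) ≤ 2 ^ (L * x * b) := by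
  calc w ^ (-b) ≤ (2 ^ (-(L * x))) ^ (-b) :=
        rpow_le_rpow_of_nonpos (by positivity) h (by linarith)
    _ = _ := by rw [← rpow_mul two_pos.le]; ring_nf

/-- The multiplier factor with `d = 1 / x` and `κ = 2 ^ (-c x)`. -/
lemma multiplier_factor {c x p : ℝ} (hx : 0 < x) :
    (1 / x * ((2 : ℝ) ^ (-(c * x))) ^ (1 / x)) ^ (1 - p) = x ^ (p - 1) * 2 ^ (c * (p - 1)) := by
  rw [← rpow_mul two_pos.le, mul_rpow (by positivity) (by positivity), ← rpow_mul two_pos.le,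
    one_div, inv_rpow hx.le, ← rpow_neg hx.le]
  congr 2
  · ring
  · field_simp; ring

lemma flux_shell_bound {p q σ s K L : ℝ} (hp : 1 < p) (hσ : 0 < σ) (hσq : σ < q) (hK : 0 ≤ K)
    (hL : 0 ≤ L) (hps : p < s) (hs : p * (q / (q - (σ + q) / 2)) ≤ s) :
    ∃ c C₁ : ℝ, 0 < c ∧ 0 ≤ C₁ ∧ ∀ x y X φ u w v lam : ℝ, 1 ≤ x → (p - 1) / x ≤ (q - σ) / 2 →
      2 ^ (-(2 * x)) ≤ y → y ≤ 1 → 0 ≤ X → X ≤ y / x → 0 ≤ φ → φ ≤ 1 → 0 ≤ u →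
      2 ^ (-(L * x)) ≤ w → w ≤ 2 ^ (L * x) → w ≤ v → 0 < lam →
      K * (2 * s) ^ p * φ ^ (s - p) * X ^ p * ((1 / x * (2 ^ (-(c * x))) ^ (1 / x)) ^ (1 - p) *
        (2 ^ (-(c * x)) + u) ^ (σ + 1 / x * (p - 1))) ≤
      lam * (φ ^ s * (u ^ q * v)) +
        C₁ * (lam ^ (-(σ / (q - σ))) + lam ^ (-((σ + q) / 2 / (q - (σ + q) / 2))) + 2 ^ (-x)) *
          ((y ^ p * x⁻¹) ^ (σ / (q - σ) + 1) * w ^ (-(σ / (q - σ)))) := by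
  have hqσ : 0 < q - σ := by linarith
  set γ₀ := (σ + q) / 2 with hγ₀
  have hγ₀q : 0 < q - γ₀ := by rw [hγ₀]; linarith
  set b := σ / (q - σ) with hb
  have hb0 : 0 < b := by positivity
  set c := (1 + (2 * p + 1) * b + L * b) / σ with hc
  have hc0 : 0 < c := by positivity
  have hs0 : 0 < s := by linarith
  have hq0 : 0 < q := by linarith
  set B := K * (2 * s) ^ p * 2 ^ (c * (p - 1)) * 2 ^ γ₀ with hB
  have hB0 : 0 ≤ B := by positivity
  set D := q * (p - 1) / ((q - γ₀) * (q - σ)) with hD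
  have hD0 : 0 ≤ D := div_nonneg (mul_nonneg hq0.le (by linarith)) (by positivity)
  set C₂ := (max 1 B) ^ (q / (q - γ₀)) * 2 ^ (L * D) with hC₂
  have hC₂0 : 0 ≤ C₂ := by positivity
  refine ⟨c, B + C₂, hc0, by positivity, ?_⟩
  intro x y X φ u w v lam hx hxn hy0 hy1 hX0 hX hφ0 hφ1 hu hw0 hw1 hwv hl
  have hx0 : 0 < x := by linarith
  have hy : 0 < y := lt_of_lt_of_le (by positivity) hy0
  have hw : 0 < w := lt_of_lt_of_le (by positivity) hw0
  have hv : 0 < v := hw.trans_le hwv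
  set γ := σ + 1 / x * (p - 1) with hγ
  have hγσ : σ ≤ γ := by
    have : 0 ≤ 1 / x * (p - 1) := mul_nonneg (by positivity) (by linarith)
    linarith
  have hγγ : γ ≤ γ₀ := by
    have : 1 / x * (p - 1) = (p - 1) / x := by ring
    rw [hγ, hγ₀, this]; linarith
  have hqγ : 0 < q - γ := by linarith
  set t := y ^ p * x⁻¹ with ht
  have ht0 : 0 < t := by positivity
  have ht1 : t ≤ 1 := by
    have h1 : y ^ p ≤ 1 := rpow_le_one hy.le hy1 (by linarith)
    have h2 : x⁻¹ ≤ 1 := inv_le_one_of_one_le₀ hx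
    calc t ≤ 1 * 1 := by rw [ht]; gcongr
      _ = 1 := one_mul 1
  set κ : ℝ := 2 ^ (-(c * x)) with hκ
  have hκ0 : 0 < κ := by positivity
  have hκ1 : κ ≤ 1 := rpow_le_one_of_one_le_of_nonpos one_le_two (by nlinarith)
  have h_split : K * (2 * s) ^ p * φ ^ (s - p) * X ^ p * ((1 / x * κ ^ (1 / x)) ^ (1 - p) *
      (κ + u) ^ γ) ≤ B * t * φ ^ (s - p) * u ^ γ + B * t * κ ^ γ := by
    rw [multiplier_factor hx0]
    have h1 : X ^ p * x ^ (p - 1) ≤ t := by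
      calc X ^ p * x ^ (p - 1) ≤ (y / x) ^ p * x ^ (p - 1) := by gcongr
        _ = t := by
          rw [div_rpow hy.le hx0.le, rpow_sub_one hx0.ne', ht]
          have : x ^ p ≠ 0 := by positivity
          field_simp
    have h2 : (κ + u) ^ γ ≤ 2 ^ γ₀ * (κ ^ γ + u ^ γ) := by
      refine (add_rpow_le_two_rpow_mul hκ0.le hu (by linarith)).trans ?_
      gcongr
      exact one_le_two
    have h3 : φ ^ (s - p) ≤ 1 := rpow_le_one hφ0 hφ1 (by linarith)
    calc _ = K * (2 * s) ^ p * 2 ^ (c * (p - 1)) * φ ^ (s - p) * (X ^ p * x ^ (p - 1)) *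
          (κ + u) ^ γ := by ring
      _ ≤ K * (2 * s) ^ p * 2 ^ (c * (p - 1)) * φ ^ (s - p) * t *
          (2 ^ γ₀ * (κ ^ γ + u ^ γ)) := by gcongr
      _ = B * t * φ ^ (s - p) * u ^ γ + B * t * φ ^ (s - p) * κ ^ γ := by rw [hB]; ring
      _ ≤ B * t * φ ^ (s - p) * u ^ γ + B * t * 1 * κ ^ γ := by gcongr
      _ = _ := by ring
  -- the part containing the solution
  have hsγ : p * (q / (q - γ)) ≤ s := by
    refine le_trans ?_ hs
    gcongr
  have h_young := weighted_young (mul_nonneg hB0 ht0.le) hφ0 hφ1 hu hv hl (by linarith)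
    (by linarith : γ < q) hps hsγ
  set η := γ / (q - γ) with hη
  have hbη : b ≤ η := by
    rw [hb, hη]; gcongr
  have hηh : η ≤ γ₀ / (q - γ₀) := by
    rw [hη]; gcongr
  have hηb : (η - b) * x ≤ D := by
    have h1 : η - b = q * (p - 1) / ((q - γ) * (q - σ)) / x := by
      rw [hη, hb, div_sub_div _ _ hqγ.ne' hqσ.ne', div_div, div_eq_div_iff (by positivity)
        (by positivity)]
      have : γ * x = σ * x + (p - 1) := by rw [hγ]; field_simp
      linear_combination (q - γ) * (q - σ) * q * this
    rw [h1, div_mul_cancel₀ _ hx0.ne', hD]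
    gcongr
  have h_lam : lam ^ (-η) ≤ lam ^ (-b) + lam ^ (-(γ₀ / (q - γ₀))) := rpow_neg_le_add hl hbη hηh
  have hq1 : q / (q - γ) = η + 1 := by rw [hη]; field_simp; ring
  have h_scale : (B * t) ^ (q / (q - γ)) * v ^ (-η) ≤ C₂ * (t ^ (b + 1) * w ^ (-b)) := by
    have h1 : B ^ (q / (q - γ)) ≤ (max 1 B) ^ (q / (q - γ₀)) := by
      calc B ^ (q / (q - γ)) ≤ (max 1 B) ^ (q / (q - γ)) := by
            gcongr; exact le_max_right _ _
        _ ≤ _ := by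
          refine rpow_le_rpow_of_exponent_le (le_max_left _ _) ?_
          gcongr
    have h2 : t ^ (q / (q - γ)) ≤ t ^ (b + 1) :=
      rpow_le_rpow_of_exponent_ge ht0 ht1 (by rw [hq1]; linarith)
    have h3 : v ^ (-η) ≤ w ^ (-b) * 2 ^ (L * D) := by
      calc v ^ (-η) ≤ w ^ (-η) := rpow_le_rpow_of_nonpos hw hwv (by linarith)
        _ = w ^ (-b) * w ^ (-(η - b)) := by rw [← rpow_add hw]; ring_nf
        _ ≤ w ^ (-b) * 2 ^ (L * x * (η - b)) := by
          gcongr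
          exact rpow_upper_scale (by linarith) hw0
        _ ≤ _ := by
          refine mul_le_mul_of_nonneg_left ?_ (by positivity)
          refine rpow_le_rpow_of_exponent_le one_le_two ?_
          calc L * x * (η - b) = L * ((η - b) * x) := by ring
            _ ≤ L * D := by gcongr
    rw [mul_rpow hB0 ht0.le]
    calc _ ≤ (max 1 B) ^ (q / (q - γ₀)) * t ^ (b + 1) * (w ^ (-b) * 2 ^ (L * D)) := by gcongr
      _ = _ := by rw [hC₂]; ring
  -- the part containing the regularization
  have h_reg : t * κ ^ γ ≤ 2 ^ (-x) * (t ^ (b + 1) * w ^ (-b)) := by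
    have h1 : κ ^ γ ≤ κ ^ σ := rpow_le_rpow_of_exponent_ge hκ0 hκ1 hγσ
    have h2 : κ ^ σ = 2 ^ (-x) * 2 ^ (-((2 * p + 1) * x * b)) * 2 ^ (-(L * x * b)) := by
      rw [hκ, ← rpow_mul two_pos.le, ← rpow_add two_pos, ← rpow_add two_pos, hc]
      congr 1
      field_simp
      ring
    have h3 : (2 : ℝ) ^ (-((2 * p + 1) * x * b)) ≤ t ^ b := by
      have h4 : (2 : ℝ) ^ (-((2 * p + 1) * x)) ≤ t := by
        have h5 : x ≤ 2 ^ x := by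
          have := one_add_mul_self_le_rpow_one_add (s := 1) (by norm_num) hx
          norm_num at this
          linarith
        calc (2 : ℝ) ^ (-((2 * p + 1) * x)) = (2 ^ (-(2 * x))) ^ p * (2 ^ x)⁻¹ := by
              rw [← rpow_mul two_pos.le, ← rpow_neg two_pos.le, ← rpow_add two_pos]
              ring_nf
          _ ≤ y ^ p * x⁻¹ := by gcongr
      calc (2 : ℝ) ^ (-((2 * p + 1) * x * b)) = (2 ^ (-((2 * p + 1) * x))) ^ b := by
            rw [← rpow_mul two_pos.le]; ring_nf
        _ ≤ t ^ b := by gcongr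
    calc t * κ ^ γ ≤ t * (2 ^ (-x) * t ^ b * w ^ (-b)) := by
          refine mul_le_mul_of_nonneg_left (h1.trans ?_) ht0.le
          rw [h2]
          gcongr
          exact rpow_lower_scale hb0.le hw hw1
      _ = _ := by rw [rpow_add_one ht0.ne']; ring
  set M := lam ^ (-b) + lam ^ (-(γ₀ / (q - γ₀))) with hM
  have hM0 : 0 ≤ M := by positivity
  set Z := t ^ (b + 1) * w ^ (-b) with hZ
  have hZ0 : 0 ≤ Z := by positivity
  have h_young_scaled : lam ^ (-η) * ((B * t) ^ (q / (q - γ)) * v ^ (-η)) ≤ M * (C₂ * Z) := by gcongr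
  have h_reg_scaled : B * t * κ ^ γ ≤ B * (2 ^ (-x) * Z) := by
    rw [mul_assoc]; gcongr
  have h2x : (0 : ℝ) < 2 ^ (-x) := by positivity
  have e1 : 0 ≤ B * M * Z := by positivity
  have e2 : 0 ≤ C₂ * 2 ^ (-x) * Z := by positivity
  calc _ ≤ _ := h_split
    _ ≤ (lam * (φ ^ s * (u ^ q * v)) + M * (C₂ * Z)) + B * (2 ^ (-x) * Z) := by linarith
    _ ≤ _ := by linarith

end ShellBounds

section TimeShell

lemma time_shell_bound {q s c : ℝ} (hq : 1 < q) (hs1 : 1 < s) (hs : q / (q - 1) ≤ s)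
    (hc : 0 ≤ c) :
    ∃ C₁ : ℝ, 0 ≤ C₁ ∧ ∀ x y Y φ u w v lam : ℝ, 1 ≤ x → 0 < y → Y ≤ c * (y / x) →
      0 ≤ φ → φ ≤ 1 → 0 ≤ u → 0 < w → w ≤ v → 0 < lam →
      2 * s * φ ^ (s - 1) * Y * u ≤ lam * (φ ^ s * (u ^ q * v)) +
        C₁ * lam ^ (-(1 / (q - 1))) *
          ((y * x⁻¹) ^ (1 / (q - 1) + 1) * w ^ (-(1 / (q - 1)))) := by
  have hq1 : 0 < q - 1 := by linarith
  have hs0 : 0 < s := by linarith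
  refine ⟨(2 * s * c) ^ (q / (q - 1)), by positivity, ?_⟩
  intro x y Y φ u w v lam hx hy hY hφ0 hφ1 hu hw hwv hl
  have hx0 : 0 < x := by linarith
  have hv : 0 < v := hw.trans_le hwv
  have h1 := weighted_young (b := 2 * s * c * (y * x⁻¹)) (by positivity) hφ0 hφ1 hu hv hl
    one_pos hq hs1 (by rwa [one_mul])
  rw [rpow_one] at h1
  have h2 : q / (q - 1) = 1 / (q - 1) + 1 := by field_simp; ring
  have h3 : (2 * s * c * (y * x⁻¹)) ^ (q / (q - 1)) * v ^ (-(1 / (q - 1))) ≤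
      (2 * s * c) ^ (q / (q - 1)) * ((y * x⁻¹) ^ (1 / (q - 1) + 1) * w ^ (-(1 / (q - 1)))) := by
    rw [mul_rpow (by positivity) (by positivity), ← h2, mul_assoc]
    have : v ^ (-(1 / (q - 1))) ≤ w ^ (-(1 / (q - 1))) :=
      rpow_le_rpow_of_nonpos hw hwv (by simp only [Left.neg_nonpos_iff]; positivity)
    gcongr
  calc 2 * s * φ ^ (s - 1) * Y * u ≤ 2 * s * φ ^ (s - 1) * (c * (y / x)) * u := by gcongr
    _ = 2 * s * c * (y * x⁻¹) * φ ^ (s - 1) * u := by ring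
    _ ≤ _ := h1
    _ ≤ lam * (φ ^ s * (u ^ q * v)) + lam ^ (-(1 / (q - 1))) *
        ((2 * s * c) ^ (q / (q - 1)) * ((y * x⁻¹) ^ (1 / (q - 1) + 1) *
          w ^ (-(1 / (q - 1))))) := by gcongr
    _ = _ := by ring

end TimeShell

section Ramp

/-- The piecewise linear function equal to `1` on `(-∞, r ^ k]` and to `0` on
`[r ^ (k + 1), ∞)`. -/
def ramp (r : ℝ) (k : ℕ) (x : ℝ) : ℝ := min 1 (max 0 ((r ^ (k + 1) - x) / (r ^ (k + 1) - r ^ k)))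

variable {r : ℝ} {k : ℕ}

lemma ramp_nonneg (r : ℝ) (k : ℕ) (x : ℝ) : 0 ≤ ramp r k x := by unfold ramp; positivity

lemma ramp_le_one (r : ℝ) (k : ℕ) (x : ℝ) : ramp r k x ≤ 1 := min_le_left _ _

lemma ramp_gap_pos (hr : 1 < r) (k : ℕ) : 0 < r ^ (k + 1) - r ^ k :=
  sub_pos.2 (pow_lt_pow_right₀ hr k.lt_succ_self)

lemma ramp_eq_one (hr : 1 < r) {x : ℝ} (hx : x ≤ r ^ k) : ramp r k x = 1 := by
  have : 1 ≤ (r ^ (k + 1) - x) / (r ^ (k + 1) - r ^ k) := by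
    rw [one_le_div (ramp_gap_pos hr k)]; linarith
  exact min_eq_left (this.trans (le_max_right _ _))

lemma ramp_eq_zero (hr : 1 < r) {x : ℝ} (hx : r ^ (k + 1) ≤ x) : ramp r k x = 0 := by
  have : (r ^ (k + 1) - x) / (r ^ (k + 1) - r ^ k) ≤ 0 :=
    div_nonpos_of_nonpos_of_nonneg (by linarith) (ramp_gap_pos hr k).le
  unfold ramp
  rw [max_eq_left this]; norm_num

lemma lipschitzWith_ramp (hr : 1 < r) (k : ℕ) :
    LipschitzWith (Real.toNNReal ((r ^ k)⁻¹ * (r - 1)⁻¹)) (ramp r k) := by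
  have hg := ramp_gap_pos hr k
  have h1 : LipschitzWith (Real.toNNReal ((r ^ k)⁻¹ * (r - 1)⁻¹))
      (fun x : ℝ => (r ^ (k + 1) - x) / (r ^ (k + 1) - r ^ k)) := by
    refine LipschitzWith.of_dist_le_mul fun x y => le_of_eq ?_
    have h2 : (r ^ k)⁻¹ * (r - 1)⁻¹ = (r ^ (k + 1) - r ^ k)⁻¹ := by
      rw [← mul_inv]; ring_nf
    rw [h2, Real.coe_toNNReal _ (by positivity), Real.dist_eq, Real.dist_eq,
      ← abs_of_pos (inv_pos.2 hg), ← abs_mul, ← abs_neg]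
    congr 1
    ring
  exact (h1.const_max 0).const_min 1

variable {E : Type*} [NormedAddCommGroup E]

lemma fderiv_ramp_comp_eq_zero [NormedSpace ℝ E] (hr : 1 < r) {F : E → ℝ} {z : E}
    (h : F z ≤ r ^ k ∨ r ^ (k + 1) ≤ F z) : fderiv ℝ (fun z => ramp r k (F z)) z = 0 := by
  rcases h with h | h
  · refine IsLocalMax.fderiv_eq_zero (Filter.Eventually.of_forall fun y => ?_)
    beta_reduce
    rw [ramp_eq_one hr h]; exact ramp_le_one _ _ _
  · refine IsLocalMin.fderiv_eq_zero (Filter.Eventually.of_forall fun y => ?_)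
    beta_reduce
    rw [ramp_eq_zero hr h]; exact ramp_nonneg _ _ _

lemma LipNear.add {f g : E → ℝ} {z : E} (hf : LipNear f z) (hg : LipNear g z) :
    LipNear (fun x => f x + g x) z := by
  obtain ⟨K, t, ht, h⟩ := hf
  obtain ⟨K₂, t₂, ht₂, h₂⟩ := hg
  exact ⟨K + K₂, t ∩ t₂, Filter.inter_mem ht ht₂,
    (h.mono inter_subset_left).add (h₂.mono inter_subset_right)⟩

lemma LipNear.sum {ι : Type*} (s : Finset ι) {f : ι → E → ℝ} {z : E}
    (hf : ∀ i ∈ s, LipNear (f i) z) : LipNear (fun x => ∑ i ∈ s, f i x) z := by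
  classical
  induction s using Finset.induction_on with
  | empty => simpa using (LipschitzWith.const (α := E) (0 : ℝ)).lipNear z
  | insert i s hi ih =>
    simp only [Finset.sum_insert hi]
    exact (hf i (Finset.mem_insert_self i s)).add
      (ih fun j hj => hf j (Finset.mem_insert_of_mem hj))

end Ramp

section AveragedCutoff

variable {N : ℕ} {r : ℝ} {n : ℕ}

/-- The average over `k ∈ [n, 2n)` of cutoffs at spatial scale `2 ^ k` and time scale `r ^ k`. -/
def avgCutoff (r : ℝ) (n : ℕ) (z : Euc N × ℝ) : ℝ :=
  (n : ℝ)⁻¹ * ∑ k ∈ Finset.Ico n (2 * n), ramp 2 k ‖z.1‖ * ramp r k |z.2|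

lemma avgCutoff_nonneg (r : ℝ) (n : ℕ) (z : Euc N × ℝ) : 0 ≤ avgCutoff r n z :=
  mul_nonneg (by positivity)
    (Finset.sum_nonneg fun _ _ => mul_nonneg (ramp_nonneg _ _ _) (ramp_nonneg _ _ _))

lemma avgCutoff_le_one (r : ℝ) (hn : 1 ≤ n) (z : Euc N × ℝ) : avgCutoff r n z ≤ 1 := by
  have h1 : ∑ k ∈ Finset.Ico n (2 * n), ramp 2 k ‖z.1‖ * ramp r k |z.2| ≤ (n : ℝ) := by
    calc _ ≤ ∑ k ∈ Finset.Ico n (2 * n), (1 : ℝ) := Finset.sum_le_sum fun k _ =>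
          mul_le_one₀ (ramp_le_one _ _ _) (ramp_nonneg _ _ _) (ramp_le_one _ _ _)
      _ = n := by simp [two_mul]
  have hn' : (0 : ℝ) < n := by exact_mod_cast hn
  calc avgCutoff r n z ≤ (n : ℝ)⁻¹ * n := by unfold avgCutoff; gcongr
    _ = 1 := inv_mul_cancel₀ hn'.ne'

lemma avgCutoff_eq_one (hr : 1 < r) (hn : 1 ≤ n) {z : Euc N × ℝ} (hx : ‖z.1‖ ≤ 2 ^ n)
    (ht : |z.2| ≤ r ^ n) : avgCutoff r n z = 1 := by
  have h1 : ∑ k ∈ Finset.Ico n (2 * n), ramp 2 k ‖z.1‖ * ramp r k |z.2| = (n : ℝ) := by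
    calc _ = ∑ k ∈ Finset.Ico n (2 * n), (1 : ℝ) := by
          refine Finset.sum_congr rfl fun k hk => ?_
          have hk' := (Finset.mem_Ico.1 hk).1
          rw [ramp_eq_one one_lt_two (hx.trans (pow_le_pow_right₀ one_le_two hk')),
            ramp_eq_one hr (ht.trans (pow_le_pow_right₀ hr.le hk')), one_mul]
      _ = n := by simp [two_mul]
  have hn' : (0 : ℝ) < n := by exact_mod_cast hn
  rw [avgCutoff, h1, inv_mul_cancel₀ hn'.ne']

lemma le_of_avgCutoff_ne_zero (hr : 1 < r) {z : Euc N × ℝ} (h : avgCutoff r n z ≠ 0) :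
    ‖z.1‖ ≤ 2 ^ (2 * n) ∧ |z.2| ≤ r ^ (2 * n) := by
  by_contra hz
  refine h ?_
  rw [avgCutoff, Finset.sum_eq_zero, mul_zero]
  intro k hk
  have hk' : k + 1 ≤ 2 * n := (Finset.mem_Ico.1 hk).2
  by_cases hx : ‖z.1‖ ≤ 2 ^ (2 * n)
  · have ht : r ^ (2 * n) < |z.2| := by
      by_contra! ht
      exact hz ⟨hx, ht⟩
    rw [ramp_eq_zero hr ((pow_le_pow_right₀ hr.le hk').trans ht.le), mul_zero]
  · rw [ramp_eq_zero one_lt_two ((pow_le_pow_right₀ one_le_two hk').trans (not_le.1 hx).le),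
      zero_mul]

lemma lipschitzWith_ramp_norm (k : ℕ) :
    LipschitzWith (Real.toNNReal ((2 ^ k : ℝ)⁻¹)) (fun z : Euc N × ℝ => ramp 2 k ‖z.1‖) := by
  have h := (lipschitzWith_ramp (r := 2) one_lt_two k).comp
    (lipschitzWith_one_norm.comp (LipschitzWith.prod_fst (α := Euc N) (β := ℝ)))
  norm_num at h
  simpa [Function.comp_def] using h

lemma lipschitzWith_ramp_abs (hr : 1 < r) (k : ℕ) :
    LipschitzWith (Real.toNNReal ((r ^ k)⁻¹ * (r - 1)⁻¹))
      (fun z : Euc N × ℝ => ramp r k |z.2|) := by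
  have h := (lipschitzWith_ramp hr k).comp
    (lipschitzWith_one_norm.comp (LipschitzWith.prod_snd (α := Euc N) (β := ℝ)))
  simpa [Function.comp_def] using h

lemma exists_lipschitzWith_avgCutoff (hr : 1 < r) (n : ℕ) :
    ∃ L, LipschitzWith L (avgCutoff (N := N) r n) := by
  refine LocallyLipschitz.exists_lipschitzWith ?_ ?_
  · rw [locallyLipschitz_iff_lipNear]
    intro z
    exact ((LipschitzWith.const (n : ℝ)⁻¹).lipNear z).mul (LipNear.sum _ fun k _ =>
      ((lipschitzWith_ramp_norm k).lipNear z).mul ((lipschitzWith_ramp_abs hr k).lipNear z))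
  · refine HasCompactSupport.intro ((isCompact_closedBall (0 : Euc N) (2 ^ (2 * n))).prod
      (isCompact_closedBall (0 : ℝ) (r ^ (2 * n)))) fun z hz => ?_
    by_contra h
    have := le_of_avgCutoff_ne_zero hr h
    exact hz ⟨by simpa using this.1, by simpa using this.2⟩

/-- All the ramps entering the averaged cutoffs are differentiable at `z`. -/
def RampsDifferentiable (r : ℝ) (z : Euc N × ℝ) : Prop :=
  ∀ k : ℕ, DifferentiableAt ℝ (fun z : Euc N × ℝ => ramp 2 k ‖z.1‖) z ∧
    DifferentiableAt ℝ (fun z : Euc N × ℝ => ramp r k |z.2|) z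

lemma ae_rampsDifferentiable (hr : 1 < r) :
    ∀ᵐ z : Euc N × ℝ, RampsDifferentiable r z := by
  rw [show (∀ᵐ z : Euc N × ℝ, RampsDifferentiable r z) ↔ _ from ae_all_iff]
  intro k
  filter_upwards [(lipschitzWith_ramp_norm (N := N) k).ae_differentiableAt,
    (lipschitzWith_ramp_abs (N := N) hr k).ae_differentiableAt] with z h1 h2 using ⟨h1, h2⟩

lemma fderiv_avgCutoff {z : Euc N × ℝ} (hz : RampsDifferentiable r z) (v : Euc N × ℝ) :
    fderiv ℝ (avgCutoff r n) z v = (n : ℝ)⁻¹ * ∑ k ∈ Finset.Ico n (2 * n),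
      (ramp 2 k ‖z.1‖ * fderiv ℝ (fun z : Euc N × ℝ => ramp r k |z.2|) z v +
        ramp r k |z.2| * fderiv ℝ (fun z : Euc N × ℝ => ramp 2 k ‖z.1‖) z v) := by
  have h1 : HasFDerivAt (avgCutoff (N := N) r n) _ z :=
    (HasFDerivAt.fun_sum (u := Finset.Ico n (2 * n)) fun k _ =>
      ((hz k).1.hasFDerivAt.fun_mul (hz k).2.hasFDerivAt)).const_mul (n : ℝ)⁻¹
  rw [h1.fderiv]
  simp

lemma pow_shell_unique {ρ x : ℝ} (hρ : 1 < ρ) {j k : ℕ} (hj : ρ ^ j < x ∧ x < ρ ^ (j + 1))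
    (hk : ρ ^ k < x ∧ x < ρ ^ (k + 1)) : j = k := by
  have h1 : j < k + 1 := (pow_lt_pow_iff_right₀ hρ).1 (hj.1.trans hk.2)
  have h2 : k < j + 1 := (pow_lt_pow_iff_right₀ hρ).1 (hk.1.trans hj.2)
  omega

lemma spaceSlope_avgCutoff (hr : 1 < r) {z : Euc N × ℝ} (hz : RampsDifferentiable r z) :
    spaceSlope (avgCutoff r n) z = 0 ∨ ∃ k ∈ Finset.Ico n (2 * n), 2 ^ k < ‖z.1‖ ∧
      ‖z.1‖ < 2 ^ (k + 1) ∧ |z.2| < r ^ (k + 1) ∧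
      spaceSlope (avgCutoff r n) z ≤ (2 ^ k : ℝ)⁻¹ / n := by
  have hd : ∀ w : Euc N, fderiv ℝ (avgCutoff r n) z (w, 0) = (n : ℝ)⁻¹ *
      ∑ k ∈ Finset.Ico n (2 * n),
        ramp r k |z.2| * fderiv ℝ (fun z : Euc N × ℝ => ramp 2 k ‖z.1‖) z (w, 0) := by
    intro w
    rw [fderiv_avgCutoff hz]
    congr 1
    refine Finset.sum_congr rfl fun k _ => ?_
    rw [fderiv_comp_snd (k := fun t => ramp r k |t|) (hz k).2]
    simp
  have hterm : ∀ k, ¬ ((2 ^ k < ‖z.1‖ ∧ ‖z.1‖ < 2 ^ (k + 1)) ∧ |z.2| < r ^ (k + 1)) →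
      ∀ w : Euc N, ramp r k |z.2| * fderiv ℝ (fun z : Euc N × ℝ => ramp 2 k ‖z.1‖) z (w, 0) = 0 := by
    intro k hk w
    by_cases h1 : 2 ^ k < ‖z.1‖ ∧ ‖z.1‖ < 2 ^ (k + 1)
    · rw [ramp_eq_zero hr (not_lt.1 fun h => hk ⟨h1, h⟩), zero_mul]
    · rw [fderiv_ramp_comp_eq_zero one_lt_two (F := fun z : Euc N × ℝ => ‖z.1‖)]
      · simp
      · by_contra! h
        exact h1 h
  by_cases hex : ∃ k ∈ Finset.Ico n (2 * n),
      (2 ^ k < ‖z.1‖ ∧ ‖z.1‖ < 2 ^ (k + 1)) ∧ |z.2| < r ^ (k + 1)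
  · right
    obtain ⟨k, hk, hk1, hk2⟩ := hex
    refine ⟨k, hk, hk1.1, hk1.2, hk2, ?_⟩
    refine ContinuousLinearMap.opNorm_le_bound _ (by positivity) fun w => ?_
    have h1 : fderiv ℝ (avgCutoff r n) z (w, 0) = (n : ℝ)⁻¹ * (ramp r k |z.2| *
        fderiv ℝ (fun z : Euc N × ℝ => ramp 2 k ‖z.1‖) z (w, 0)) := by
      rw [hd w, Finset.sum_eq_single_of_mem k hk]
      intro j _ hjk
      exact hterm j (fun hj => hjk (pow_shell_unique one_lt_two hj.1 hk1)) w
    have h2 := (abs_fderiv_space_le (fun z : Euc N × ℝ => ramp 2 k ‖z.1‖) z w).trans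
      (mul_le_mul_of_nonneg_right (spaceSlope_le (lipschitzWith_ramp_norm k) z) (norm_nonneg w))
    rw [Real.coe_toNNReal _ (by positivity)] at h2
    have h3 := ramp_nonneg r k |z.2|
    have h4 := ramp_le_one r k |z.2|
    rw [ContinuousLinearMap.comp_apply, ContinuousLinearMap.inl_apply, Real.norm_eq_abs, h1,
      abs_mul, abs_mul, abs_of_nonneg h3, abs_of_nonneg (by positivity : (0 : ℝ) ≤ (n : ℝ)⁻¹)]
    calc _ ≤ (n : ℝ)⁻¹ * (1 * ((2 ^ k : ℝ)⁻¹ * ‖w‖)) := by gcongr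
      _ = _ := by ring
  · left
    refine le_antisymm (ContinuousLinearMap.opNorm_le_bound _ le_rfl fun w => ?_)
      (spaceSlope_nonneg _ _)
    rw [ContinuousLinearMap.comp_apply, ContinuousLinearMap.inl_apply, hd w,
      Finset.sum_eq_zero fun k hk => hterm k (fun h => hex ⟨k, hk, h⟩) w]
    simp

lemma timeSlope_avgCutoff (hr : 1 < r) {z : Euc N × ℝ} (hz : RampsDifferentiable r z) :
    timeSlope (avgCutoff r n) z = 0 ∨ ∃ k ∈ Finset.Ico n (2 * n), r ^ k < |z.2| ∧
      |z.2| < r ^ (k + 1) ∧ ‖z.1‖ < 2 ^ (k + 1) ∧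
      timeSlope (avgCutoff r n) z ≤ (r - 1)⁻¹ * ((r ^ k)⁻¹ / n) := by
  have hd : fderiv ℝ (avgCutoff r n) z (0, 1) = (n : ℝ)⁻¹ *
      ∑ k ∈ Finset.Ico n (2 * n),
        ramp 2 k ‖z.1‖ * fderiv ℝ (fun z : Euc N × ℝ => ramp r k |z.2|) z (0, 1) := by
    rw [fderiv_avgCutoff hz]
    congr 1
    refine Finset.sum_congr rfl fun k _ => ?_
    rw [fderiv_comp_fst_time (k := fun x => ramp 2 k ‖x‖) (hz k).1]
    simp
  have hterm : ∀ k, ¬ ((r ^ k < |z.2| ∧ |z.2| < r ^ (k + 1)) ∧ ‖z.1‖ < 2 ^ (k + 1)) →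
      ramp 2 k ‖z.1‖ * fderiv ℝ (fun z : Euc N × ℝ => ramp r k |z.2|) z (0, 1) = 0 := by
    intro k hk
    by_cases h1 : r ^ k < |z.2| ∧ |z.2| < r ^ (k + 1)
    · rw [ramp_eq_zero one_lt_two (not_lt.1 fun h => hk ⟨h1, h⟩), zero_mul]
    · rw [fderiv_ramp_comp_eq_zero hr (F := fun z : Euc N × ℝ => |z.2|)]
      · simp
      · by_contra! h
        exact h1 h
  by_cases hex : ∃ k ∈ Finset.Ico n (2 * n),
      (r ^ k < |z.2| ∧ |z.2| < r ^ (k + 1)) ∧ ‖z.1‖ < 2 ^ (k + 1)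
  · right
    obtain ⟨k, hk, hk1, hk2⟩ := hex
    refine ⟨k, hk, hk1.1, hk1.2, hk2, ?_⟩
    have hr1 : 0 < r - 1 := by linarith
    have h2 := timeSlope_le (lipschitzWith_ramp_abs (N := N) hr k) z
    rw [Real.coe_toNNReal _ (by positivity), timeSlope] at h2
    have h3 := ramp_nonneg 2 k ‖z.1‖
    have h4 := ramp_le_one 2 k ‖z.1‖
    rw [timeSlope, hd, Finset.sum_eq_single_of_mem k hk fun j _ hjk =>
        hterm j (fun hj => hjk (pow_shell_unique hr hj.1 hk1)),
      abs_mul, abs_mul, abs_of_nonneg h3, abs_of_nonneg (by positivity : (0 : ℝ) ≤ (n : ℝ)⁻¹)]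
    calc _ ≤ (n : ℝ)⁻¹ * (1 * ((r ^ k)⁻¹ * (r - 1)⁻¹)) := by gcongr
      _ = _ := by ring
  · left
    rw [timeSlope, hd, Finset.sum_eq_zero fun k hk => hterm k (fun h => hex ⟨k, hk, h⟩)]
    simp

end AveragedCutoff

section DyadicWeight

variable {N : ℕ} {a : Euc N → ℝ} {h : Euc N → ℝ} {g : ℝ → ℝ} {r b ω : ℝ}

/-- A sum over the dyadic cylinders `B(0, 2 ^ (k + 1)) × (0, r ^ (k + 1)]`, `k ∈ [n, 2n)`, of the
power `-b` of the separated potential, with normalising weights. -/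
def dyadicWeight (h : Euc N → ℝ) (g : ℝ → ℝ) (r b ω : ℝ) (n : ℕ) (z : Euc N × ℝ) : ℝ :=
  ∑ k ∈ Finset.Ico n (2 * n), (n : ℝ) ^ (-(b + 1)) * (ω ^ k)⁻¹ *
    ((ball 0 (2 ^ (k + 1))).indicator (fun x => h x ^ (-b)) z.1 *
      (Ioc 0 (r ^ (k + 1))).indicator (fun t => g t ^ (-b)) z.2)

lemma le_dyadicWeight (hω : 0 < ω) {z : Euc N × ℝ} (hh : 0 ≤ h z.1) (hg : 0 ≤ g z.2) {n k : ℕ}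
    (hk : k ∈ Finset.Ico n (2 * n)) (hx : ‖z.1‖ < 2 ^ (k + 1))
    (ht : z.2 ∈ Ioc 0 (r ^ (k + 1))) :
    (n : ℝ) ^ (-(b + 1)) * (ω ^ k)⁻¹ * (h z.1 * g z.2) ^ (-b) ≤ dyadicWeight h g r b ω n z := by
  have h1 : (n : ℝ) ^ (-(b + 1)) * (ω ^ k)⁻¹ * (h z.1 * g z.2) ^ (-b) =
      (n : ℝ) ^ (-(b + 1)) * (ω ^ k)⁻¹ *
    ((ball 0 (2 ^ (k + 1))).indicator (fun x => h x ^ (-b)) z.1 *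
      (Ioc 0 (r ^ (k + 1))).indicator (fun t => g t ^ (-b)) z.2) := by
    rw [indicator_of_mem (by simpa using hx), indicator_of_mem ht, mul_rpow hh hg]
  rw [h1, dyadicWeight]
  refine Finset.single_le_sum (f := fun k => (n : ℝ) ^ (-(b + 1)) * (ω ^ k)⁻¹ *
    ((ball 0 (2 ^ (k + 1))).indicator (fun x => h x ^ (-b)) z.1 *
      (Ioc 0 (r ^ (k + 1))).indicator (fun t => g t ^ (-b)) z.2)) (fun j _ => ?_) hk
  have h2 : 0 ≤ (ball 0 (2 ^ (j + 1))).indicator (fun x => h x ^ (-b)) z.1 := by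
    unfold indicator; split_ifs
    exacts [rpow_nonneg hh _, le_rfl]
  have h3 : 0 ≤ (Ioc 0 (r ^ (j + 1))).indicator (fun t => g t ^ (-b)) z.2 := by
    unfold indicator; split_ifs
    exacts [rpow_nonneg hg _, le_rfl]
  positivity

lemma dyadicWeight_nonneg (hω : 0 < ω) {z : Euc N × ℝ} (hh : 0 ≤ h z.1) (hg : 0 ≤ g z.2) (n : ℕ) :
    0 ≤ dyadicWeight h g r b ω n z := by
  refine Finset.sum_nonneg fun j _ => ?_
  have h2 : 0 ≤ (ball 0 (2 ^ (j + 1))).indicator (fun x => h x ^ (-b)) z.1 := by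
    unfold indicator; split_ifs
    exacts [rpow_nonneg hh _, le_rfl]
  have h3 : 0 ≤ (Ioc 0 (r ^ (j + 1))).indicator (fun t => g t ^ (-b)) z.2 := by
    unfold indicator; split_ifs
    exacts [rpow_nonneg hg _, le_rfl]
  positivity

lemma integrable_dyadicWeight_term
    (hhi : ∀ R, IntegrableOn (fun x => h x ^ (-b)) (ball 0 R) (muA a))
    (hgi : ∀ T, IntegrableOn (fun t => g t ^ (-b)) (Ioc 0 T)) (R T : ℝ) :
    Integrable (fun z : Euc N × ℝ => (ball 0 R).indicator (fun x => h x ^ (-b)) z.1 *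
      (Ioc 0 T).indicator (fun t => g t ^ (-b)) z.2) (muS a) := by
  refine Integrable.mul_prod ((integrable_indicator_iff measurableSet_ball).2 (hhi R)) ?_
  exact ((integrable_indicator_iff measurableSet_Ioc).2 (hgi T)).restrict

lemma integrable_dyadicWeight
    (hhi : ∀ R, IntegrableOn (fun x => h x ^ (-b)) (ball 0 R) (muA a))
    (hgi : ∀ T, IntegrableOn (fun t => g t ^ (-b)) (Ioc 0 T)) (n : ℕ) :
    Integrable (dyadicWeight h g r b ω n) (muS a) :=
  integrable_finsetSum _ fun _ _ => (integrable_dyadicWeight_term hhi hgi _ _).const_mul _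

lemma integral_dyadicWeight_term (R T : ℝ) :
    ∫ z : Euc N × ℝ, (ball 0 R).indicator (fun x => h x ^ (-b)) z.1 *
      (Ioc 0 T).indicator (fun t => g t ^ (-b)) z.2 ∂muS a =
    (∫ x in ball (0 : Euc N) R, h x ^ (-b) ∂muA a) * ∫ t in Ioc 0 T, g t ^ (-b) := by
  rw [muS, integral_prod_mul (fun x => (ball 0 R).indicator (fun x => h x ^ (-b)) x)
    (fun t => (Ioc 0 T).indicator (fun t => g t ^ (-b)) t), integral_indicator measurableSet_ball,
    integral_indicator measurableSet_Ioc, Measure.restrict_restrict measurableSet_Ioc,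
    inter_eq_left.2 Ioc_subset_Ioi_self]

lemma polylog_scale_le {ρ σ δ c : ℝ} {n k : ℕ} (hρ : 1 < ρ) (hδ : 0 ≤ δ)
    (hc : 2 * log ρ ≤ c) (hk : k < 2 * n) :
    (ρ ^ (k + 1)) ^ σ * log (ρ ^ (k + 1)) ^ δ ≤ (ρ ^ σ) ^ (k + 1) * (c * n) ^ δ := by
  have h0 : 0 ≤ log ρ := (log_pos hρ).le
  have hk' : ((k + 1 : ℕ) : ℝ) ≤ 2 * n := by exact_mod_cast hk
  rw [log_pow, ← rpow_natCast ρ, ← rpow_natCast (ρ ^ σ), ← rpow_mul (by linarith),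
    ← rpow_mul (by linarith), mul_comm σ]
  have h1 : ((k + 1 : ℕ) : ℝ) * log ρ ≤ c * n :=
    calc ((k + 1 : ℕ) : ℝ) * log ρ ≤ 2 * n * log ρ := mul_le_mul_of_nonneg_right hk' h0
      _ = 2 * log ρ * n := by ring
      _ ≤ c * n := mul_le_mul_of_nonneg_right hc (by positivity)
  exact mul_le_mul_of_nonneg_left (rpow_le_rpow (by positivity) h1 hδ) (by positivity)

lemma eventually_integral_dyadicWeight_le
    (hhi : ∀ R, IntegrableOn (fun x => h x ^ (-b)) (ball 0 R) (muA a))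
    (hgi : ∀ T, IntegrableOn (fun t => g t ^ (-b)) (Ioc 0 T)) {σ σ' δ δ' C T₀ : ℝ} (hr : 1 < r)
    (hω : (2 : ℝ) ^ σ * r ^ σ' ≤ ω) (hδ : 0 ≤ δ) (hδ' : 0 ≤ δ') (hδb : δ + δ' ≤ b) (hC : 0 ≤ C)
    (hg0 : ∀ T, 0 ≤ ∫ t in Ioc 0 T, g t ^ (-b))
    (hhR : ∀ R, T₀ ≤ R → ∫ x in ball (0 : Euc N) R, h x ^ (-b) ∂muA a ≤ C * R ^ σ * log R ^ δ)
    (hgT : ∀ T, T₀ ≤ T → ∫ t in Ioc 0 T, g t ^ (-b) ≤ C * T ^ σ' * log T ^ δ') :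
    ∃ C₂, 0 ≤ C₂ ∧ ∀ᶠ n : ℕ in Filter.atTop, ∫ z, dyadicWeight h g r b ω n z ∂muS a ≤ C₂ := by
  have hω0 : 0 < ω := lt_of_lt_of_le (by positivity) hω
  set c : ℝ := max 1 (max (2 * log 2) (2 * log r)) with hc
  have hc1 : 1 ≤ c := le_max_left _ _
  have hc2 : 2 * log 2 ≤ c := (le_max_left _ _).trans (le_max_right _ _)
  have hc3 : 2 * log r ≤ c := (le_max_right _ _).trans (le_max_right _ _)
  refine ⟨C * C * ω * c ^ b, by positivity, ?_⟩
  have ev1 := (tendsto_pow_atTop_atTop_of_one_lt (r := (2 : ℝ)) one_lt_two).eventually_ge_atTop T₀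
  have ev2 := (tendsto_pow_atTop_atTop_of_one_lt hr).eventually_ge_atTop T₀
  filter_upwards [Filter.eventually_ge_atTop 1, ev1, ev2] with n hn hn1 hn2
  have hn' : (1 : ℝ) ≤ n := by exact_mod_cast hn
  have hterm : ∀ k ∈ Finset.Ico n (2 * n), ∫ z : Euc N × ℝ, (n : ℝ) ^ (-(b + 1)) * (ω ^ k)⁻¹ *
      ((ball 0 (2 ^ (k + 1))).indicator (fun x => h x ^ (-b)) z.1 *
      (Ioc 0 (r ^ (k + 1))).indicator (fun t => g t ^ (-b)) z.2) ∂muS a ≤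
      C * C * ω * c ^ b * (n : ℝ)⁻¹ := by
    intro k hk
    obtain ⟨hk1, hk2⟩ := Finset.mem_Ico.1 hk
    have hR := hhR (2 ^ (k + 1)) (hn1.trans (pow_le_pow_right₀ one_le_two (by omega)))
    have hT := hgT (r ^ (k + 1)) (hn2.trans (pow_le_pow_right₀ hr.le (by omega)))
    have hR' : C * (2 ^ (k + 1)) ^ σ * log (2 ^ (k + 1)) ^ δ ≤
        C * ((2 ^ σ) ^ (k + 1) * (c * n) ^ δ) := by
      rw [mul_assoc]
      exact mul_le_mul_of_nonneg_left (polylog_scale_le one_lt_two hδ hc2 hk2) hC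
    have hT' : C * (r ^ (k + 1)) ^ σ' * log (r ^ (k + 1)) ^ δ' ≤
        C * ((r ^ σ') ^ (k + 1) * (c * n) ^ δ') := by
      rw [mul_assoc]
      exact mul_le_mul_of_nonneg_left (polylog_scale_le hr hδ' hc3 hk2) hC
    have hcn : 1 ≤ c * n := one_le_mul_of_one_le_of_one_le hc1 hn'
    rw [integral_const_mul, integral_dyadicWeight_term]
    have hprod : (∫ x in ball (0 : Euc N) (2 ^ (k + 1)), h x ^ (-b) ∂muA a) *
        ∫ t in Ioc 0 (r ^ (k + 1)), g t ^ (-b) ≤ C * C * ω ^ (k + 1) * (c ^ b * n ^ b) := by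
      calc _ ≤ (C * ((2 ^ σ) ^ (k + 1) * (c * n) ^ δ)) * (C * ((r ^ σ') ^ (k + 1) * (c * n) ^ δ')) :=
            mul_le_mul (hR.trans hR') (hT.trans hT') (hg0 _) (by positivity)
        _ = C * C * (2 ^ σ * r ^ σ') ^ (k + 1) * (c * n) ^ (δ + δ') := by
            rw [rpow_add (by linarith), mul_pow]; ring
        _ ≤ C * C * ω ^ (k + 1) * (c * n) ^ b := by
            gcongr
        _ = _ := by rw [mul_rpow (by linarith) (by linarith)]
    calc _ ≤ (n : ℝ) ^ (-(b + 1)) * (ω ^ k)⁻¹ * (C * C * ω ^ (k + 1) * (c ^ b * n ^ b)) := by gcongr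
      _ = C * C * ω * c ^ b * ((n : ℝ) ^ (-(b + 1)) * n ^ b) := by
          rw [pow_succ]; field_simp
      _ = _ := by
          rw [← rpow_add (by linarith), ← rpow_neg_one]; ring_nf
  calc ∫ z, dyadicWeight h g r b ω n z ∂muS a = ∑ k ∈ Finset.Ico n (2 * n), ∫ z : Euc N × ℝ,
      (n : ℝ) ^ (-(b + 1)) * (ω ^ k)⁻¹ *
      ((ball 0 (2 ^ (k + 1))).indicator (fun x => h x ^ (-b)) z.1 *
      (Ioc 0 (r ^ (k + 1))).indicator (fun t => g t ^ (-b)) z.2) ∂muS a :=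
        integral_finsetSum _ fun _ _ => (integrable_dyadicWeight_term hhi hgi _ _).const_mul _
    _ ≤ ∑ k ∈ Finset.Ico n (2 * n), C * C * ω * c ^ b * (n : ℝ)⁻¹ := Finset.sum_le_sum hterm
    _ = C * C * ω * c ^ b := by
        rw [Finset.sum_const, Nat.card_Ico, show 2 * n - n = n by omega, nsmul_eq_mul]
        field_simp

end DyadicWeight

section Pointwise

variable {N : ℕ} {r : ℝ} {n : ℕ}

/-- The part of the space-time slab on which the cutoffs at level `n` equal one. -/
def coreSet (N : ℕ) (r : ℝ) (n : ℕ) : Set (Euc N × ℝ) :=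
  {z | ‖z.1‖ ≤ 2 ^ n ∧ 2 / (n : ℝ) ≤ z.2 ∧ z.2 ≤ r ^ n}

/-- The reaction term, cut off at level `n`. -/
def cutoffEnergy (r s q : ℝ) (V u : Euc N × ℝ → ℝ) (n : ℕ) (z : Euc N × ℝ) : ℝ :=
  chi (1 / n) z.2 * avgCutoff r n z ^ s * (u z ^ q * V z)

lemma cutoffEnergy_nonneg {s q : ℝ} {V u : Euc N × ℝ → ℝ} {z : Euc N × ℝ} (hV : 0 ≤ V z)
    (hu : 0 ≤ u z) : 0 ≤ cutoffEnergy r s q V u n z :=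
  mul_nonneg (mul_nonneg (chi_nonneg _ _) (rpow_nonneg (avgCutoff_nonneg _ _ _) _))
    (mul_nonneg (rpow_nonneg hu _) hV)

lemma not_mem_coreSet_of_norm {k : ℕ} {z : Euc N × ℝ} (hk : k ∈ Finset.Ico n (2 * n))
    (hz : 2 ^ k < ‖z.1‖) : z ∈ (coreSet N r n)ᶜ := fun h =>
  absurd (h.1.trans (pow_le_pow_right₀ one_le_two (Finset.mem_Ico.1 hk).1)) (not_le.2 hz)

lemma not_mem_coreSet_of_time {k : ℕ} {z : Euc N × ℝ} (hr : 1 < r)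
    (hk : k ∈ Finset.Ico n (2 * n)) (hz : r ^ k < z.2) : z ∈ (coreSet N r n)ᶜ := fun h =>
  absurd (h.2.2.trans (pow_le_pow_right₀ hr.le (Finset.mem_Ico.1 hk).1)) (not_le.2 hz)

lemma scale_rpow_eq {ρ e b x : ℝ} (hρ : 0 < ρ) (hx : 0 < x) (k : ℕ) :
    (((ρ ^ k)⁻¹ ^ e * x⁻¹) : ℝ) ^ (b + 1) = x ^ (-(b + 1)) * ((ρ ^ (e * (b + 1))) ^ k)⁻¹ := by
  rw [mul_rpow (by positivity) (by positivity), ← rpow_mul (by positivity),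
    inv_rpow hx.le, ← rpow_neg hx.le, inv_rpow (by positivity), ← rpow_natCast ρ k,
    ← rpow_natCast (ρ ^ _) k, ← rpow_mul hρ.le, ← rpow_mul hρ.le, mul_comm (k : ℝ), mul_comm]

/-- The hypotheses on the data at a point that are used in the shell estimates. -/
structure PotentialBound (r L : ℝ) (n : ℕ) (h : Euc N → ℝ) (g : ℝ → ℝ) (V u : Euc N × ℝ → ℝ)
    (z : Euc N × ℝ) : Prop where
  ramps : RampsDifferentiable r z
  time_pos : 0 < z.2
  space_weight_pos : 0 < h z.1
  time_weight_pos : 0 < g z.2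
  two_sided : ‖z.1‖ ≤ 2 ^ (2 * n) → z.2 ≤ r ^ (2 * n) →
    (2 : ℝ) ^ (-(L * n)) ≤ h z.1 * g z.2 ∧ h z.1 * g z.2 ≤ 2 ^ (L * n)
  weight_le : h z.1 * g z.2 ≤ V z
  nonneg : 0 ≤ u z

lemma exists_flux_avgCutoff_le (N : ℕ) {p q σ s K L : ℝ} (hp : 1 < p) (hσ : 0 < σ) (hσq : σ < q)
    (hK : 0 ≤ K) (hL : 0 ≤ L) (hps : p < s) (hs : p * (q / (q - (σ + q) / 2)) ≤ s) (hr : 1 < r) :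
    ∃ c C₁ : ℝ, 0 < c ∧ 0 ≤ C₁ ∧ ∀ (n : ℕ) (h : Euc N → ℝ) (g : ℝ → ℝ) (V u : Euc N × ℝ → ℝ)
      (z : Euc N × ℝ) (lam : ℝ), 1 ≤ n → (p - 1) / n ≤ (q - σ) / 2 →
      PotentialBound r L n h g V u z → 0 < lam →
      chi (1 / n) z.2 * (K * (2 * s) ^ p * avgCutoff r n z ^ (s - p) *
        spaceSlope (avgCutoff r n) z ^ p * ((1 / n * (2 ^ (-(c * n))) ^ (1 / (n : ℝ))) ^ (1 - p) *
          (2 ^ (-(c * n)) + u z) ^ (σ + 1 / n * (p - 1)))) ≤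
      lam * (coreSet N r n)ᶜ.indicator (cutoffEnergy r s q V u n) z +
        C₁ * (lam ^ (-(σ / (q - σ))) + lam ^ (-((σ + q) / 2 / (q - (σ + q) / 2))) + 2 ^ (-(n : ℝ))) *
          dyadicWeight h g r (σ / (q - σ)) (2 ^ (p * (σ / (q - σ) + 1))) n z := by
  obtain ⟨c, C₁, hc, hC₁, hflux⟩ := flux_shell_bound hp hσ hσq hK hL hps hs
  refine ⟨c, C₁, hc, hC₁, fun n h g V u z lam hn hpn hz hlam => ?_⟩
  have hn' : (1 : ℝ) ≤ n := by exact_mod_cast hn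
  have hV : 0 ≤ V z := (mul_pos hz.space_weight_pos hz.time_weight_pos).le.trans hz.weight_le
  have hG : ∀ A : Set (Euc N × ℝ), 0 ≤ A.indicator (cutoffEnergy r s q V u n) z := fun A => by
    unfold indicator; split_ifs
    exacts [cutoffEnergy_nonneg hV hz.nonneg, le_rfl]
  have hM : 0 ≤ C₁ * (lam ^ (-(σ / (q - σ))) + lam ^ (-((σ + q) / 2 / (q - (σ + q) / 2))) +
      2 ^ (-(n : ℝ))) := by positivity
  have hW : 0 ≤ dyadicWeight h g r (σ / (q - σ)) (2 ^ (p * (σ / (q - σ) + 1))) n z :=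
    dyadicWeight_nonneg (by positivity) hz.space_weight_pos.le hz.time_weight_pos.le n
  rcases spaceSlope_avgCutoff (n := n) hr hz.ramps with h0 | ⟨k, hk, h1, h2, h3, h4⟩
  · rw [h0, zero_rpow (by linarith)]
    simp only [mul_zero, zero_mul]
    have := hG (coreSet N r n)ᶜ
    positivity
  · rw [abs_of_pos hz.time_pos] at h3
    have hk' := Finset.mem_Ico.1 hk
    have hw := hz.two_sided (h2.le.trans (pow_le_pow_right₀ one_le_two hk'.2))
      (h3.le.trans (pow_le_pow_right₀ hr.le hk'.2))
    have hy : (2 : ℝ) ^ (-(2 * (n : ℝ))) ≤ (2 ^ k)⁻¹ := by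
      rw [← rpow_natCast, ← rpow_neg zero_le_two]
      refine rpow_le_rpow_of_exponent_le one_le_two (neg_le_neg ?_)
      exact_mod_cast hk'.2.le
    have hmain := hflux n (2 ^ k)⁻¹ (spaceSlope (avgCutoff r n) z) (avgCutoff r n z) (u z)
      (h z.1 * g z.2) (V z) lam hn' hpn hy (inv_le_one_of_one_le₀ (one_le_pow₀ one_le_two))
      (spaceSlope_nonneg _ _) h4 (avgCutoff_nonneg _ _ _) (avgCutoff_le_one _ hn _) hz.nonneg
      hw.1 hw.2 hz.weight_le hlam
    rw [scale_rpow_eq two_pos (by linarith)] at hmain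
    have hD := le_dyadicWeight (b := σ / (q - σ)) (ω := 2 ^ (p * (σ / (q - σ) + 1)))
      (by positivity) hz.space_weight_pos.le
      hz.time_weight_pos.le hk h2 ⟨hz.time_pos, h3.le⟩
    rw [indicator_of_mem (not_mem_coreSet_of_norm hk h1), cutoffEnergy]
    have hmain' := hmain.trans (add_le_add_right (mul_le_mul_of_nonneg_left hD hM) _)
    refine (mul_le_mul_of_nonneg_left hmain' (chi_nonneg _ _)).trans ?_
    have h5 := mul_le_mul_of_nonneg_right (chi_le_one (1 / n) z.2) (mul_nonneg hM hW)
    linarith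

lemma exists_time_avgCutoff_le (N : ℕ) {q s L : ℝ} (hq : 1 < q) (hs1 : 1 < s)
    (hs : q / (q - 1) ≤ s) (hr : 1 < r) :
    ∃ C₁ : ℝ, 0 ≤ C₁ ∧ ∀ (n : ℕ) (h : Euc N → ℝ) (g : ℝ → ℝ) (V u : Euc N × ℝ → ℝ)
      (z : Euc N × ℝ) (lam : ℝ), 1 ≤ n → PotentialBound r L n h g V u z → 0 < lam →
      chi (1 / n) z.2 *
        (2 * s * avgCutoff r n z ^ (s - 1) * timeSlope (avgCutoff r n) z * u z) ≤
      lam * (coreSet N r n)ᶜ.indicator (cutoffEnergy r s q V u n) z +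
        C₁ * lam ^ (-(1 / (q - 1))) *
          dyadicWeight h g r (1 / (q - 1)) (r ^ (1 / (q - 1) + 1)) n z := by
  have hr1 : 0 < r - 1 := by linarith
  obtain ⟨C₁, hC₁, htime⟩ := time_shell_bound hq hs1 hs (inv_pos.2 hr1).le
  refine ⟨C₁, hC₁, fun n h g V u z lam hn hz hlam => ?_⟩
  have hn' : (1 : ℝ) ≤ n := by exact_mod_cast hn
  have hw := mul_pos hz.space_weight_pos hz.time_weight_pos
  have hV : 0 ≤ V z := hw.le.trans hz.weight_le
  have hG : ∀ A : Set (Euc N × ℝ), 0 ≤ A.indicator (cutoffEnergy r s q V u n) z := fun A => by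
    unfold indicator; split_ifs
    exacts [cutoffEnergy_nonneg hV hz.nonneg, le_rfl]
  have hM : 0 ≤ C₁ * lam ^ (-(1 / (q - 1))) := by positivity
  have hW : 0 ≤ dyadicWeight h g r (1 / (q - 1)) (r ^ (1 / (q - 1) + 1)) n z :=
    dyadicWeight_nonneg (by positivity) hz.space_weight_pos.le hz.time_weight_pos.le n
  rcases timeSlope_avgCutoff (n := n) hr hz.ramps with h0 | ⟨k, hk, h1, h2, h3, h4⟩
  · rw [h0]
    simp only [mul_zero, zero_mul]
    have := hG (coreSet N r n)ᶜ
    positivity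
  · rw [abs_of_pos hz.time_pos] at h1 h2
    have hmain := htime n (r ^ k)⁻¹ (timeSlope (avgCutoff r n) z) (avgCutoff r n z) (u z)
      (h z.1 * g z.2) (V z) lam hn' (by positivity) h4 (avgCutoff_nonneg _ _ _)
      (avgCutoff_le_one _ hn _) hz.nonneg hw hz.weight_le hlam
    have hsc := scale_rpow_eq (ρ := r) (e := 1) (b := 1 / (q - 1)) (x := n)
      (by linarith) (by linarith) k
    rw [rpow_one, one_mul] at hsc
    rw [hsc] at hmain
    have hD := le_dyadicWeight (b := 1 / (q - 1)) (ω := r ^ (1 / (q - 1) + 1))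
      (by positivity) hz.space_weight_pos.le
      hz.time_weight_pos.le hk h3 ⟨hz.time_pos, h2.le⟩
    rw [indicator_of_mem (not_mem_coreSet_of_time hr hk h1), cutoffEnergy]
    have hmain' := hmain.trans (add_le_add_right (mul_le_mul_of_nonneg_left hD hM) _)
    refine (mul_le_mul_of_nonneg_left hmain' (chi_nonneg _ _)).trans ?_
    have h5 := mul_le_mul_of_nonneg_right (chi_le_one (1 / n) z.2) (mul_nonneg hM hW)
    linarith

lemma two_rpow_bounds_of_polynomial {C α e Y v : ℝ} (hC : 0 < C) (hCe : C ≤ 2 ^ e)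
    (hα : 0 ≤ α) (hY : 0 < Y) (hYe : Y ≤ 2 ^ (3 * e)) (h1 : C⁻¹ * Y ^ (-α) ≤ v)
    (h2 : v ≤ C * Y ^ α) : (2 : ℝ) ^ (-(e * (1 + 3 * α))) ≤ v ∧ v ≤ 2 ^ (e * (1 + 3 * α)) := by
  have h3 : C * Y ^ α ≤ 2 ^ (e * (1 + 3 * α)) := by
    calc C * Y ^ α ≤ 2 ^ e * (2 ^ (3 * e)) ^ α := by gcongr
      _ = _ := by
        rw [← rpow_mul zero_le_two, ← rpow_add two_pos]; ring_nf
  refine ⟨?_, h2.trans h3⟩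
  rw [rpow_neg zero_le_two]
  refine le_trans ?_ h1
  rw [rpow_neg hY.le, ← mul_inv]
  exact inv_anti₀ (by positivity) h3

lemma exists_two_sided_bound {C α₁ α₂ : ℝ} (hC : 0 < C) (hα₁ : 0 ≤ α₁) (hα₂ : 0 ≤ α₂)
    (hr : 1 < r) : ∃ L : ℝ, 0 ≤ L ∧ ∀ (n : ℕ) (x t v w : ℝ), 1 ≤ n → 0 ≤ x → 0 ≤ t →
      x ≤ 2 ^ (2 * n) → t ≤ r ^ (2 * n) →
      C⁻¹ * (1 + x) ^ (-α₁) ≤ v → v ≤ C * (1 + x) ^ α₁ →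
      C⁻¹ * (1 + t) ^ (-α₂) ≤ w → w ≤ C * (1 + t) ^ α₂ →
      (2 : ℝ) ^ (-(L * n)) ≤ v * w ∧ v * w ≤ 2 ^ (L * n) := by
  obtain ⟨c, hc⟩ : ∃ c : ℕ, max (max C r) 2 < 2 ^ c := pow_unbounded_of_one_lt _ one_lt_two
  have hc1 : 1 ≤ c := by
    rcases Nat.eq_zero_or_pos c with h | h
    · have := (le_max_right _ _).trans_lt hc
      norm_num [h] at this
    · exact h
  have hcC : C ≤ 2 ^ c := ((le_max_left _ _).trans (le_max_left _ _)).trans hc.le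
  have hcr : r ≤ 2 ^ c := ((le_max_right _ _).trans (le_max_left _ _)).trans hc.le
  refine ⟨c * (2 + 3 * α₁ + 3 * α₂), by positivity, ?_⟩
  intro n x t v w hn hx ht hxn htn h1 h2 h3 h4
  have hcn : 1 ≤ c * n := Nat.mul_pos hc1 hn
  have hC' : C ≤ (2 : ℝ) ^ ((c : ℝ) * n) := by
    rw [← Nat.cast_mul, rpow_natCast]
    exact hcC.trans (pow_le_pow_right₀ one_le_two (Nat.le_mul_of_pos_right _ hn))
  have hY : ∀ ξ : ℝ, ξ ≤ 2 ^ (2 * (c * n)) → 1 + ξ ≤ (2 : ℝ) ^ (3 * ((c : ℝ) * n)) := by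
    intro ξ hξ
    rw [show (3 * ((c : ℝ) * n)) = ((3 * (c * n) : ℕ) : ℝ) by push_cast; ring, rpow_natCast]
    calc 1 + ξ ≤ 2 ^ (2 * (c * n)) + 2 ^ (2 * (c * n)) :=
          add_le_add (one_le_pow₀ one_le_two) hξ
      _ = 2 ^ (2 * (c * n) + 1) := by ring
      _ ≤ _ := pow_le_pow_right₀ one_le_two (by omega)
  have hx' : x ≤ 2 ^ (2 * (c * n)) :=
    hxn.trans (pow_le_pow_right₀ one_le_two (Nat.mul_le_mul_left 2 (Nat.le_mul_of_pos_left _ hc1)))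
  have ht' : t ≤ 2 ^ (2 * (c * n)) := by
    calc t ≤ r ^ (2 * n) := htn
      _ ≤ (2 ^ c) ^ (2 * n) := pow_le_pow_left₀ (by linarith) hcr _
      _ = _ := by rw [← pow_mul]; ring_nf
  have b1 := two_rpow_bounds_of_polynomial hC hC' hα₁ (by linarith) (hY x hx') h1 h2
  have b2 := two_rpow_bounds_of_polynomial hC hC' hα₂ (by linarith) (hY t ht') h3 h4
  have e1 : (c : ℝ) * (2 + 3 * α₁ + 3 * α₂) * n =
    c * n * (1 + 3 * α₁) + c * n * (1 + 3 * α₂) := by ring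
  have p1 : (0 : ℝ) < 2 ^ (-((c : ℝ) * n * (1 + 3 * α₁))) := by positivity
  have p2 : (0 : ℝ) < 2 ^ (-((c : ℝ) * n * (1 + 3 * α₂))) := by positivity
  rw [e1, neg_add, rpow_add two_pos, rpow_add two_pos]
  exact ⟨mul_le_mul b1.1 b2.1 p2.le (p1.le.trans b1.1),
    mul_le_mul b1.2 b2.2 (p2.le.trans b2.1) (by positivity)⟩

end Pointwise

section Conclusion

/-- An absorption argument: a nonnegative function whose energies on an exhaustion are
controlled by an arbitrarily large multiple of the energy outside plus a small error vanishes. -/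
lemma ae_eq_zero_of_absorbed_energy {α : Type*} [MeasurableSpace α] {μ : Measure α} {F : α → ℝ}
    {G : ℕ → α → ℝ} {B : ℕ → Set α} {M : ℝ → ℝ} {C₀ : ℝ} (hB : AECover μ Filter.atTop B)
    (hF : 0 ≤ᵐ[μ] F) (hG0 : ∀ n, 0 ≤ᵐ[μ] G n) (hGF : ∀ᶠ n in Filter.atTop, G n ≤ᵐ[μ] F)
    (hGB : ∀ᶠ n in Filter.atTop, ∀ z ∈ B n, G n z = F z)
    (hM : Filter.Tendsto M Filter.atTop (𝓝 0))
    (hint : ∀ᶠ n in Filter.atTop, Integrable (G n) μ)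
    (hC₀ : 0 ≤ C₀)
    (h : ∀ᶠ n : ℕ in Filter.atTop, ∀ lam : ℝ, 0 < lam → ∫ z, G n z ∂μ ≤
      2 * lam * (∫ z in (B n)ᶜ, G n z ∂μ) + C₀ * (M lam + 2 ^ (-(n : ℝ)))) : F =ᵐ[μ] 0 := by
  obtain ⟨n₀, hn₀⟩ := Filter.eventually_atTop.1 ((hGB.and hGF).and (hint.and h))
  have hBG : ∀ n, n₀ ≤ n → IntegrableOn F (B n) μ ∧ ∫ z in B n, F z ∂μ ≤ ∫ z, G n z ∂μ := by
    intro n hn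
    obtain ⟨⟨h1, -⟩, h2, -⟩ := hn₀ n hn
    refine ⟨h2.integrableOn.congr_fun h1 (hB.measurableSet n), ?_⟩
    rw [← setIntegral_congr_fun (hB.measurableSet n) h1]
    exact setIntegral_le_integral h2 (hG0 n)
  have hB' : AECover μ Filter.atTop fun n => B (n + n₀) :=
    hB.comp_tendsto (Filter.tendsto_add_atTop_nat n₀)
  have hFint : Integrable F μ := by
    refine hB'.integrable_of_integral_bounded_of_nonneg_ae (2 * (C₀ * (M (1 / 4) + 1)))
      (fun n => (hBG _ (by omega)).1) hF (Filter.Eventually.of_forall fun n => ?_)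
    obtain ⟨-, h2, h3⟩ := hn₀ (n + n₀) (by omega)
    have h4 := h3 (1 / 4) (by norm_num)
    have h5 : ∫ z in (B (n + n₀))ᶜ, G (n + n₀) z ∂μ ≤ ∫ z, G (n + n₀) z ∂μ :=
      setIntegral_le_integral h2 (hG0 _)
    have h6 : (2 : ℝ) ^ (-((n + n₀ : ℕ) : ℝ)) ≤ 1 :=
      rpow_le_one_of_one_le_of_nonpos one_le_two (neg_nonpos.2 (Nat.cast_nonneg _))
    have h7 := (hBG (n + n₀) (by omega)).2
    have h8 : C₀ * (M (1 / 4) + 2 ^ (-((n + n₀ : ℕ) : ℝ))) ≤ C₀ * (M (1 / 4) + 1) := by gcongr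
    linarith
  have hlim : Filter.Tendsto (fun n => ∫ z in B n, F z ∂μ) Filter.atTop (𝓝 (∫ z, F z ∂μ)) :=
    hB.integral_tendsto_of_countably_generated hFint
  have hpow : Filter.Tendsto (fun n : ℕ => (2 : ℝ) ^ (-(n : ℝ))) Filter.atTop (𝓝 0) :=
    (tendsto_rpow_atBot_of_base_gt_one 2 one_lt_two).comp
      (Filter.tendsto_neg_atTop_atBot.comp tendsto_natCast_atTop_atTop)
  have hle : ∀ lam : ℝ, 0 < lam → ∫ z, F z ∂μ ≤ C₀ * M lam := by
    intro lam hlam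
    have h9 : Filter.Tendsto (fun n : ℕ => 2 * lam * (∫ z, F z ∂μ - ∫ z in B n, F z ∂μ) +
        C₀ * (M lam + 2 ^ (-(n : ℝ)))) Filter.atTop
        (𝓝 (2 * lam * (∫ z, F z ∂μ - ∫ z, F z ∂μ) + C₀ * (M lam + 0))) :=
      ((tendsto_const_nhds.sub hlim).const_mul _).add ((hpow.const_add _).const_mul _)
    rw [sub_self, mul_zero, zero_add, add_zero] at h9
    refine le_of_tendsto_of_tendsto hlim h9 ?_
    filter_upwards [Filter.eventually_ge_atTop n₀] with n hn
    obtain ⟨⟨-, h1⟩, h2, h3⟩ := hn₀ n hn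
    have h10 : ∫ z in (B n)ᶜ, G n z ∂μ ≤ ∫ z in (B n)ᶜ, F z ∂μ :=
      integral_mono_ae h2.integrableOn hFint.integrableOn (ae_restrict_of_ae h1)
    have h11 := integral_add_compl (hB.measurableSet n) hFint
    have h12 : ∫ z in (B n)ᶜ, G n z ∂μ ≤ ∫ z, F z ∂μ - ∫ z in B n, F z ∂μ := by linarith
    exact ((hBG n hn).2.trans (h3 lam hlam)).trans (by gcongr)
  have hzero : ∫ z, F z ∂μ ≤ 0 := by
    have h13 := hM.const_mul C₀
    rw [mul_zero] at h13
    exact ge_of_tendsto h13 ((Filter.eventually_gt_atTop 0).mono hle)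
  exact (integral_eq_zero_iff_of_nonneg_ae hF hFint).1 (le_antisymm hzero (integral_nonneg_of_ae hF))

variable {N : ℕ} {r : ℝ}

lemma measurableSet_coreSet (n : ℕ) : MeasurableSet (coreSet N r n) := by
  have h1 : MeasurableSet {z : Euc N × ℝ | ‖z.1‖ ≤ 2 ^ n} :=
    measurableSet_le (by fun_prop) (by fun_prop)
  have h2 : MeasurableSet {z : Euc N × ℝ | 2 / (n : ℝ) ≤ z.2} :=
    measurableSet_le (by fun_prop) (by fun_prop)
  have h3 : MeasurableSet {z : Euc N × ℝ | z.2 ≤ r ^ n} :=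
    measurableSet_le (by fun_prop) (by fun_prop)
  exact h1.inter (h2.inter h3)

lemma aecover_coreSet {a : Euc N → ℝ} (ha : Continuous a) (hr : 1 < r) :
    AECover (muS a) Filter.atTop (coreSet N r) where
  measurableSet := measurableSet_coreSet
  ae_eventually_mem := by
    filter_upwards [ae_muS_mem_Sset ha] with z hz
    filter_upwards [(tendsto_pow_atTop_atTop_of_one_lt (r := (2 : ℝ))
        one_lt_two).eventually_ge_atTop ‖z.1‖,
      (tendsto_pow_atTop_atTop_of_one_lt hr).eventually_ge_atTop z.2,
      (tendsto_const_div_atTop_nhds_zero_nat 2).eventually_le_const (show 0 < z.2 from hz)]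
      with n h1 h2 h3 using ⟨h1, h3, h2⟩

lemma cutoffEnergy_le {s q : ℝ} {V u : Euc N × ℝ → ℝ} {z : Euc N × ℝ} (hs : 0 ≤ s)
    (hV : 0 ≤ V z) (hu : 0 ≤ u z) {n : ℕ} (hn : 1 ≤ n) :
    cutoffEnergy r s q V u n z ≤ u z ^ q * V z := by
  refine mul_le_of_le_one_left (mul_nonneg (rpow_nonneg hu _) hV) ?_
  exact mul_le_one₀ (chi_le_one _ _) (rpow_nonneg (avgCutoff_nonneg _ _ _) _)
    (rpow_le_one (avgCutoff_nonneg _ _ _) (avgCutoff_le_one _ hn _) hs)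

lemma cutoffEnergy_eq {s q : ℝ} {V u : Euc N × ℝ → ℝ} {z : Euc N × ℝ} (hr : 1 < r) {n : ℕ}
    (hn : 1 ≤ n) (hz : z ∈ coreSet N r n) :
    cutoffEnergy r s q V u n z = u z ^ q * V z := by
  have hn' : (0 : ℝ) < n := by exact_mod_cast hn
  have h0 : 0 ≤ z.2 := le_trans (by positivity) hz.2.1
  rw [cutoffEnergy, chi_eq_one (by positivity) (by rw [mul_one_div]; exact hz.2.1),
    avgCutoff_eq_one hr hn hz.1 (by rw [abs_of_nonneg h0]; exact hz.2.2), one_rpow]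
  ring

/-- The energy inequality obtained by testing with the averaged cutoffs. -/
lemma IsWeakSol.exists_cutoffEnergy_le {p m q K L C₂ C₃ : ℝ} {V : Euc N × ℝ → ℝ} {f : ℝ → ℝ}
    {a : Euc N → ℝ} {u : Euc N × ℝ → ℝ} {gu : Euc N × ℝ → Euc N} {ut : Euc N × ℝ → ℝ}
    {h : Euc N → ℝ} {g : ℝ → ℝ} (hu : IsWeakSol N p m q V f a u gu ut)
    (hp : 1 < p) (hm : 1 ≤ m) (hq1 : 1 < q) (hσq : p + m - 2 < q) (hK : 0 ≤ K) (hL : 0 ≤ L)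
    (hr : 1 < r) (ha : Continuous a) (hf : ∀ r, 0 ≤ r → 0 ≤ f r ∧ f r ≤ K)
    (hV : ∀ᵐ z ∂muS a, 0 < V z)
    (hpot : ∀ᵐ z ∂muS a, ∀ n, 1 ≤ n → PotentialBound r L n h g V u z)
    (hC₂ : 0 ≤ C₂) (hC₃ : 0 ≤ C₃)
    (hW₂ : ∀ n, Integrable (dyadicWeight h g r ((p + m - 2) / (q - (p + m - 2)))
      (2 ^ (p * ((p + m - 2) / (q - (p + m - 2)) + 1))) n) (muS a))
    (hW₂' : ∀ᶠ n in Filter.atTop, ∫ z, dyadicWeight h g r ((p + m - 2) / (q - (p + m - 2)))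
      (2 ^ (p * ((p + m - 2) / (q - (p + m - 2)) + 1))) n z ∂muS a ≤ C₂)
    (hW₃ : ∀ n, Integrable (dyadicWeight h g r (1 / (q - 1)) (r ^ (1 / (q - 1) + 1)) n) (muS a))
    (hW₃' : ∀ᶠ n in Filter.atTop,
      ∫ z, dyadicWeight h g r (1 / (q - 1)) (r ^ (1 / (q - 1) + 1)) n z ∂muS a ≤ C₃) :
    ∃ (s C₀ : ℝ) (M : ℝ → ℝ), 0 ≤ s ∧ 0 ≤ C₀ ∧ Filter.Tendsto M Filter.atTop (𝓝 0) ∧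
      ∀ᶠ n : ℕ in Filter.atTop, Integrable (cutoffEnergy r s q V u n) (muS a) ∧
        ∀ lam : ℝ, 0 < lam → ∫ z, cutoffEnergy r s q V u n z ∂muS a ≤
          2 * lam * (∫ z in (coreSet N r n)ᶜ, cutoffEnergy r s q V u n z ∂muS a) +
            C₀ * (M lam + 2 ^ (-(n : ℝ))) := by
  set σ := p + m - 2 with hσ
  have hσ0 : 0 < σ := by linarith
  have hqσ : 0 < q - σ := by linarith
  obtain ⟨s, hs⟩ := exists_gt (max p (max (p * (q / (q - (σ + q) / 2))) (q / (q - 1))))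
  have hps : p < s := (le_max_left _ _).trans_lt hs
  have hs2 : p * (q / (q - (σ + q) / 2)) ≤ s :=
    ((le_max_left _ _).trans (le_max_right _ _)).trans hs.le
  have hs3 : q / (q - 1) ≤ s := ((le_max_right _ _).trans (le_max_right _ _)).trans hs.le
  obtain ⟨c, C₁, hc, hC₁, hflux⟩ := exists_flux_avgCutoff_le N hp hσ0 hσq hK hL hps hs2 hr
  obtain ⟨C₁', hC₁', htime⟩ := exists_time_avgCutoff_le N (L := L) hq1 (hp.trans hps) hs3 hr
  set e₁ := σ / (q - σ) with he₁
  set e₂ := (σ + q) / 2 / (q - (σ + q) / 2) with he₂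
  set e₃ := 1 / (q - 1) with he₃
  have he₁0 : 0 < e₁ := by positivity
  have he₂0 : 0 < e₂ := div_pos (by linarith) (by linarith)
  have he₃0 : 0 < e₃ := div_pos one_pos (by linarith)
  have hC₀ : 0 ≤ C₁ * C₂ + C₁' * C₃ := by positivity
  refine ⟨s, C₁ * C₂ + C₁' * C₃, fun lam => lam ^ (-e₁) + lam ^ (-e₂) + lam ^ (-e₃),
    by linarith, hC₀, ?_, ?_⟩
  · simpa using ((tendsto_rpow_neg_atTop he₁0).add (tendsto_rpow_neg_atTop he₂0)).add
      (tendsto_rpow_neg_atTop he₃0)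
  have ev := (tendsto_const_div_atTop_nhds_zero_nat (p - 1)).eventually_le_const
    (show 0 < (q - σ) / 2 by linarith)
  filter_upwards [hW₂', hW₃', Filter.eventually_ge_atTop 2, ev] with n hn2 hn3 hn hpn
  have hn' : (2 : ℝ) ≤ n := by exact_mod_cast hn
  obtain ⟨Lφ, hLφ⟩ := exists_lipschitzWith_avgCutoff (N := N) hr n
  obtain ⟨hI1, hI2, hI3⟩ := hu.integral_le_errorTerm hp hm ha hf hV hLφ
    (avgCutoff_nonneg r n) (avgCutoff_le_one r (by omega))
    (fun z hz => (le_of_avgCutoff_ne_zero hr hz).imp_right (le_of_abs_le))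
    (β := 1 / n) (by positivity) hps (d := 1 / n) (by positivity)
    (by rw [div_lt_one (by linarith)]; linarith) (κ := 2 ^ (-(c * n))) (by positivity)
  refine ⟨hI1, fun lam hlam => hI3.trans ?_⟩
  have hpt : ∀ᵐ z ∂muS a, errorTerm p K s (1 / n) (2 ^ (-(c * n))) (σ + 1 / n * (p - 1)) (1 / n)
      (avgCutoff r n) u z ≤
      2 * lam * (coreSet N r n)ᶜ.indicator (cutoffEnergy r s q V u n) z +
      C₁ * (lam ^ (-e₁) + lam ^ (-e₂) + 2 ^ (-(n : ℝ))) *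
        dyadicWeight h g r e₁ (2 ^ (p * (e₁ + 1))) n z +
      C₁' * lam ^ (-e₃) * dyadicWeight h g r e₃ (r ^ (e₃ + 1)) n z := by
    filter_upwards [hpot] with z hz
    have h1 := hflux n h g V u z lam (by omega) hpn (hz n (by omega)) hlam
    have h2 := htime n h g V u z lam (by omega) (hz n (by omega)) hlam
    rw [errorTerm, mul_add]
    linarith
  have hJ1 : Integrable ((coreSet N r n)ᶜ.indicator (cutoffEnergy r s q V u n)) (muS a) :=
    Integrable.indicator hI1 (measurableSet_coreSet n).compl
  have hJ := (hJ1.const_mul (2 * lam)).add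
    ((hW₂ n).const_mul (C₁ * (lam ^ (-e₁) + lam ^ (-e₂) + 2 ^ (-(n : ℝ)))))
  have hJ' := (hW₃ n).const_mul (C₁' * lam ^ (-e₃))
  have hmono := integral_mono_ae hI2 (hJ.add hJ') hpt
  refine hmono.trans ?_
  rw [integral_add' hJ hJ', integral_add' (hJ1.const_mul (2 * lam)) ((hW₂ n).const_mul _),
    integral_const_mul, integral_const_mul, integral_const_mul,
    integral_indicator (measurableSet_coreSet n).compl]
  have k1 : C₁ * (lam ^ (-e₁) + lam ^ (-e₂) + 2 ^ (-(n : ℝ))) *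
      (∫ z, dyadicWeight h g r e₁ (2 ^ (p * (e₁ + 1))) n z ∂muS a) ≤
      C₁ * (lam ^ (-e₁) + lam ^ (-e₂) + 2 ^ (-(n : ℝ))) * C₂ :=
    mul_le_mul_of_nonneg_left hn2 (by positivity)
  have k2 : C₁' * lam ^ (-e₃) *
      (∫ z, dyadicWeight h g r e₃ (r ^ (e₃ + 1)) n z ∂muS a) ≤ C₁' * lam ^ (-e₃) * C₃ :=
    mul_le_mul_of_nonneg_left hn3 (by positivity)
  have k3 : 0 ≤ C₁ * lam ^ (-e₃) * C₂ := by positivity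
  have k4 : 0 ≤ C₁' * (lam ^ (-e₁) + lam ^ (-e₂) + 2 ^ (-(n : ℝ))) * C₃ := by positivity
  nlinarith [k1, k2, k3, k4]

end Conclusion

section SeparatedPotential

lemma exists_anisotropic_scale {σ₁ σ₂ σ₃ σ₄ A B : ℝ} (hσ₁ : 0 ≤ σ₁) (hσ₄ : 0 ≤ σ₄)
    (h₂ : σ₂ ≤ A) (h₃ : σ₃ ≤ B) (hA : σ₂ = A → σ₁ = 0) (hB : σ₃ = B → σ₄ = 0)
    (h : σ₁ * σ₄ ≤ (A - σ₂) * (B - σ₃)) :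
    ∃ θ : ℝ, 0 < θ ∧ σ₁ + θ * σ₂ ≤ θ * A ∧ σ₃ + θ * σ₄ ≤ B := by
  rcases hσ₄.eq_or_lt with h0 | h0
  · refine ⟨σ₁ / (A - σ₂) + 1, ?_, ?_, by rw [← h0]; linarith⟩
    · have := div_nonneg hσ₁ (sub_nonneg.2 h₂)
      linarith
    · rcases h₂.eq_or_lt with h1 | h1
      · rw [h1, hA h1]; linarith
      · have h2 : σ₁ / (A - σ₂) * (A - σ₂) = σ₁ := div_mul_cancel₀ _ (sub_pos.2 h1).ne'
        linarith
  · have h1 : σ₃ < B := lt_of_le_of_ne h₃ fun h' => h0.ne' (hB h')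
    refine ⟨(B - σ₃) / σ₄, div_pos (sub_pos.2 h1) h0, ?_, ?_⟩
    · have h2 : σ₁ ≤ (A - σ₂) * (B - σ₃) / σ₄ := (le_div_iff₀ h0).2 h
      have h3 : (B - σ₃) / σ₄ * A - (B - σ₃) / σ₄ * σ₂ = (A - σ₂) * (B - σ₃) / σ₄ := by ring
      linarith
    · rw [div_mul_cancel₀ _ h0.ne']; linarith

/-- A negative power of a function with a polynomial lower bound is integrable on bounded sets. -/
lemma integrableOn_rpow_neg_of_lower_bound {X : Type*} [MeasurableSpace X]
    {μ : Measure X} {w ℓ : X → ℝ} {A : Set X} (hA : MeasurableSet A) (hμA : μ A ≠ ∞)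
    (hw : Measurable w) {C α b R : ℝ} (hC : 0 < C) (hα : 0 ≤ α) (hb : 0 ≤ b)
    (hℓ : ∀ x ∈ A, 0 ≤ ℓ x ∧ ℓ x ≤ R)
    (hlow : ∀ᵐ x ∂μ.restrict A, C⁻¹ * (1 + ℓ x) ^ (-α) ≤ w x) :
    IntegrableOn (fun x => w x ^ (-b)) A μ := by
  refine Measure.integrableOn_of_bounded (M := (C⁻¹ * (1 + R) ^ (-α)) ^ (-b)) hμA
    (hw.pow_const _).aestronglyMeasurable ?_
  filter_upwards [hlow, ae_restrict_mem hA] with x hx hxA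
  obtain ⟨h0, h1⟩ := hℓ x hxA
  have hpos : 0 < C⁻¹ * (1 + R) ^ (-α) :=
    mul_pos (inv_pos.2 hC) (rpow_pos_of_pos (by linarith) _)
  have h2 : C⁻¹ * (1 + R) ^ (-α) ≤ w x := by
    refine le_trans ?_ hx
    exact mul_le_mul_of_nonneg_left
      (rpow_le_rpow_of_nonpos (by linarith) (by linarith) (neg_nonpos.2 hα)) (inv_pos.2 hC).le
  rw [Real.norm_of_nonneg (rpow_nonneg (hpos.le.trans h2) _)]
  exact rpow_le_rpow_of_nonpos hpos h2 (neg_nonpos.2 hb)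

end SeparatedPotential

/-- Corollary 1.8 (Euclidean specialization): separated-variables potential, two-sided bounds. -/
theorem corollary_separated_potential_twosided
    (N : ℕ) (hN : 1 ≤ N) (p m q K : ℝ)
    (hp : 1 < p) (hm : 1 ≤ m) (hq : max (p + m - 2) 1 < q) (hK : 0 < K)
    (V : Euc N × ℝ → ℝ) (f : ℝ → ℝ) (a : Euc N → ℝ)
    (hVmeas : Measurable V)
    (hVpos : ∀ᵐ z ∂ ((volume : Measure (Euc N × ℝ)).restrict (Sset N)), 0 < V z)
    (hVloc : LocallyIntegrableOn V (Sset N) (muS a))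
    (hf : ∀ s : ℝ, 0 ≤ s → 0 ≤ f s ∧ f s ≤ K)
    (haLip : LocallyLipschitz a)
    (haPos : ∀ᵐ x ∂ (volume : Measure (Euc N)), 0 < a x)
    (h : Euc N → ℝ) (g : ℝ → ℝ) (hhmeas : Measurable h) (hgmeas : Measurable g)
    (α1 α2 σ1 σ2 σ3 σ4 δ1 δ2 δ3 δ4 C : ℝ)
    (hα1 : 0 ≤ α1) (hα2 : 0 ≤ α2) (hσ1 : 0 ≤ σ1) (hσ2 : 0 ≤ σ2) (hσ3 : 0 ≤ σ3)
    (hσ4 : 0 ≤ σ4) (hδ1 : 0 ≤ δ1) (hδ2 : 0 ≤ δ2) (hδ3 : 0 ≤ δ3) (hδ4 : 0 ≤ δ4)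
    (hC : 0 < C)
    (hVlow : ∀ᵐ z ∂ ((volume : Measure (Euc N × ℝ)).restrict (Sset N)),
      h z.1 * g z.2 ≤ V z)
    (hh : ∀ᵐ x ∂ (volume : Measure (Euc N)),
      C⁻¹ * (1 + ‖x‖) ^ (-α1) ≤ h x ∧ h x ≤ C * (1 + ‖x‖) ^ α1)
    (hg : ∀ᵐ t ∂ ((volume : Measure ℝ).restrict (Set.Ioi (0 : ℝ))),
      C⁻¹ * (1 + t) ^ (-α2) ≤ g t ∧ g t ≤ C * (1 + t) ^ α2)
    (hint : ∃ T0 : ℝ, 1 < T0 ∧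
      (∀ R, T0 ≤ R →
        (∫ x in Metric.ball (0 : Euc N) R, h x ^ (-(1 / (q - 1))) ∂ muA a)
          ≤ C * R ^ σ1 * Real.log R ^ δ1 ∧
        (∫ x in Metric.ball (0 : Euc N) R,
            h x ^ (-((p + m - 2) / (q - p - m + 2))) ∂ muA a)
          ≤ C * R ^ σ3 * Real.log R ^ δ3) ∧
      (∀ T, T0 ≤ T →
        (∫ t in Set.Ioc (0 : ℝ) T, g t ^ (-(1 / (q - 1))))
          ≤ C * T ^ σ2 * Real.log T ^ δ2 ∧
        (∫ t in Set.Ioc (0 : ℝ) T, g t ^ (-((p + m - 2) / (q - p - m + 2))))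
          ≤ C * T ^ σ4 * Real.log T ^ δ4))
    (hcond1 : δ1 + δ2 ≤ 1 / (q - 1))
    (hcond1' : δ3 + δ4 ≤ (p + m - 2) / (q - p - m + 2))
    (hcond2 : σ2 ≤ q / (q - 1)) (hcond2' : σ3 ≤ p * q / (q - p - m + 2))
    (hcond3 : σ2 = q / (q - 1) → σ1 = 0)
    (hcond3' : σ3 = p * q / (q - p - m + 2) → σ4 = 0)
    (hcond4 : σ1 * σ4 ≤ (q / (q - 1) - σ2) * (p * q / (q - p - m + 2) - σ3))
    (u : Euc N × ℝ → ℝ) (gu : Euc N × ℝ → Euc N) (ut : Euc N × ℝ → ℝ)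
    (hu : IsWeakSol N p m q V f a u gu ut) :
    ∀ᵐ z ∂ ((volume : Measure (Euc N × ℝ)).restrict (Sset N)), u z = 0 := by


  have hq0 : p + m - 2 < q := (le_max_left _ _).trans_lt hq
  have hq1 : 1 < q := (le_max_right _ _).trans_lt hq
  have hσ0 : 0 < p + m - 2 := by linarith
  have hqσ : 0 < q - (p + m - 2) := by linarith
  have hq1' : 0 < q - 1 := by linarith
  rw [show q - p - m + 2 = q - (p + m - 2) by ring] at *
  have hA : q / (q - 1) = 1 / (q - 1) + 1 := by field_simp; ring
  have hB : p * q / (q - (p + m - 2)) = p * ((p + m - 2) / (q - (p + m - 2)) + 1) := by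
    field_simp; ring
  obtain ⟨θ, hθ, hθ1, hθ2⟩ := exists_anisotropic_scale hσ1 hσ4 hcond2 hcond2' hcond3 hcond3' hcond4
  set r : ℝ := 2 ^ θ with hr_def
  have hr : 1 < r := one_lt_rpow one_lt_two hθ
  have hω1 : (2 : ℝ) ^ σ1 * r ^ σ2 ≤ r ^ (1 / (q - 1) + 1) := by
    rw [hr_def, ← rpow_mul zero_le_two, ← rpow_mul zero_le_two, ← rpow_add two_pos, ← hA]
    exact rpow_le_rpow_of_exponent_le one_le_two hθ1
  have hω2 : (2 : ℝ) ^ σ3 * r ^ σ4 ≤ 2 ^ (p * ((p + m - 2) / (q - (p + m - 2)) + 1)) := by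
    rw [hr_def, ← rpow_mul zero_le_two, ← rpow_add two_pos, ← hB]
    exact rpow_le_rpow_of_exponent_le one_le_two hθ2
  have ha : Continuous a := haLip.continuous
  have hac := muS_absolutelyContinuous ha
  have hVpos' : ∀ᵐ z ∂muS a, 0 < V z := hac.ae_le hVpos
  have hhA : ∀ᵐ x ∂muA a, C⁻¹ * (1 + ‖x‖) ^ (-α1) ≤ h x ∧ h x ≤ C * (1 + ‖x‖) ^ α1 :=
    (withDensity_absolutelyContinuous _ _).ae_le hh
  have := isLocallyFiniteMeasure_muA ha
  have hhi : ∀ b : ℝ, 0 ≤ b → ∀ R, IntegrableOn (fun x => h x ^ (-b)) (ball 0 R) (muA a) :=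
    fun b hb R => integrableOn_rpow_neg_of_lower_bound measurableSet_ball measure_ball_lt_top.ne
      hhmeas hC hα1 hb (ℓ := fun x => ‖x‖) (R := R)
      (fun x hx => ⟨norm_nonneg x, (mem_ball_zero_iff.1 hx).le⟩)
      (ae_restrict_of_ae (hhA.mono fun _ hx => hx.1))
  have hgIoc : ∀ T, ∀ᵐ t ∂(volume : Measure ℝ).restrict (Ioc 0 T),
      C⁻¹ * (1 + t) ^ (-α2) ≤ g t :=
    fun T => ae_restrict_of_ae_restrict_of_subset Ioc_subset_Ioi_self (hg.mono fun _ ht => ht.1)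
  have hgi : ∀ b : ℝ, 0 ≤ b → ∀ T, IntegrableOn (fun t => g t ^ (-b)) (Ioc 0 T) :=
    fun b hb T => integrableOn_rpow_neg_of_lower_bound measurableSet_Ioc measure_Ioc_lt_top.ne
      hgmeas hC hα2 hb (ℓ := fun t => t) (R := T) (fun t ht => ⟨ht.1.le, ht.2⟩) (hgIoc T)
  have hg0 : ∀ b T : ℝ, 0 ≤ ∫ t in Ioc 0 T, g t ^ (-b) := fun b T => by
    refine integral_nonneg_of_ae ?_
    filter_upwards [hgIoc T, ae_restrict_mem measurableSet_Ioc] with t ht ht'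
    have h1 : 0 < 1 + t := by linarith [ht'.1]
    exact rpow_nonneg (le_trans (by positivity) ht) _
  obtain ⟨L, hL, hLbound⟩ := exists_two_sided_bound hC hα1 hα2 hr
  have hpot : ∀ᵐ z ∂muS a, ∀ n, 1 ≤ n → PotentialBound r L n h g V u z := by
    filter_upwards [hac.ae_le (ae_restrict_of_ae (ae_rampsDifferentiable hr)), hac.ae_le hVlow,
      ae_muS_mem_Sset ha, Measure.quasiMeasurePreserving_fst.ae hhA,
      Measure.quasiMeasurePreserving_snd.ae hg] with z h1 h2 h3 h4 h5 n hn
    have h3' : 0 < z.2 := h3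
    have h6 : 0 < 1 + z.2 := by linarith
    exact ⟨h1, h3', lt_of_lt_of_le (by positivity) h4.1, lt_of_lt_of_le (by positivity) h5.1,
      fun hx ht => hLbound n _ _ _ _ hn (norm_nonneg _) h3'.le hx ht h4.1 h4.2 h5.1 h5.2, h2,
      hu.nonneg z h3⟩
  obtain ⟨T₀, -, hintR, hintT⟩ := hint
  have hb1 : 0 ≤ 1 / (q - 1) := by positivity
  have hb2 : 0 ≤ (p + m - 2) / (q - (p + m - 2)) := by positivity
  obtain ⟨C₃, hC₃, hW₃⟩ := eventually_integral_dyadicWeight_le (hhi _ hb1) (hgi _ hb1) hr hω1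
    hδ1 hδ2 hcond1 hC.le (hg0 _) (fun R hR => (hintR R hR).1) (fun T hT => (hintT T hT).1)
  obtain ⟨C₂, hC₂, hW₂⟩ := eventually_integral_dyadicWeight_le (hhi _ hb2) (hgi _ hb2) hr hω2
    hδ3 hδ4 hcond1' hC.le (hg0 _) (fun R hR => (hintR R hR).2) (fun T hT => (hintT T hT).2)
  obtain ⟨s, C₀, M, hs, hC₀, hM, hen⟩ := hu.exists_cutoffEnergy_le hp hm hq1 hq0 hK.le hL hr ha
    hf hVpos' hpot hC₂ hC₃ (integrable_dyadicWeight (hhi _ hb2) (hgi _ hb2)) hW₂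
    (integrable_dyadicWeight (hhi _ hb1) (hgi _ hb1)) hW₃
  have hnn : ∀ᵐ z ∂muS a, 0 < V z ∧ 0 ≤ u z := by
    filter_upwards [hVpos', ae_muS_mem_Sset ha] with z h1 h2 using ⟨h1, hu.nonneg z h2⟩
  have hzero : (fun z => u z ^ q * V z) =ᵐ[muS a] 0 :=
    ae_eq_zero_of_absorbed_energy (aecover_coreSet ha hr)
      (hnn.mono fun z hz => mul_nonneg (rpow_nonneg hz.2 _) hz.1.le)
      (fun n => hnn.mono fun z hz => cutoffEnergy_nonneg hz.1.le hz.2)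
      ((Filter.eventually_ge_atTop 1).mono fun n hn =>
        hnn.mono fun z hz => cutoffEnergy_le hs hz.1.le hz.2 hn)
      ((Filter.eventually_ge_atTop 1).mono fun n hn z hz => cutoffEnergy_eq hr hn hz)
      hM (hen.mono fun n hn => hn.1) hC₀ (hen.mono fun n hn => hn.2)
  refine (absolutelyContinuous_muS ha haPos).ae_le ?_
  filter_upwards [hzero, hnn] with z hz hz'
  have h1 : u z ^ q = 0 := (mul_eq_zero.1 hz).resolve_right hz'.1.ne'
  exact (rpow_eq_zero hz'.2 (by linarith)).1 h1

end
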